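/- If a is a primed involution word for an element of I_ℤ, then P_EGᴼ(unprime(a)) = unprime(P_EGᴼ(a)) and Q_EGᴼ(unprime(a)) = unprime_diag(Q_EGᴼ(a)). -/

import Mathlib

/-! ## Primed letters: the alphabet `ℤ ⊔ ℤ'`, with `i' = i - 1/2`.
A letter is encoded by its "ceiling" together with a flag recording whether it is primed. -/

structure Letter where
  ceil : ℤ
  primed : Bool
deriving DecidableEq, Repr

instance : Inhabited Letter := ⟨⟨0, false⟩⟩

/-- The order `⋯ < 1' < 1 < 2' < 2 < ⋯`. -/
instance : LinearOrder Letter :=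
  LinearOrder.lift' (fun x : Letter => toLex (x.ceil, !x.primed))
    (fun a b h => by
      have h' : (a.ceil, !a.primed) = (b.ceil, !b.primed) := toLex.injective h
      obtain ⟨ac, ap⟩ := a
      obtain ⟨bc, bp⟩ := b
      simp only [Prod.mk.injEq] at h'
      obtain ⟨h1, h2⟩ := h'
      cases ap <;> cases bp <;> simp_all)

/-- A primed word. -/
abbrev PWord := List Letter

def Letter.unprime (x : Letter) : Letter := ⟨x.ceil, false⟩

def Letter.succL (x : Letter) : Letter := ⟨x.ceil + 1, x.primed⟩

/-- `unprime` of a primed word: replace each letter `x` by `⌈x⌉`. -/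
def unprimeWord (a : PWord) : List ℤ := a.map Letter.ceil

/-- `unprime` of a primed word, as a primed word with no primes. -/
def unprimeP (a : PWord) : PWord := a.map Letter.unprime

/-! ## Involution words -/

/-- The simple transposition `s_i = (i, i+1)` of `ℤ`. -/
def sPerm (i : ℤ) : Equiv.Perm ℤ := Equiv.swap i (i + 1)

/-- The Demazure product `s_{w_1} ∘ s_{w_2} ∘ ⋯ ∘ s_{w_k}` of a word, computed by the
defining recursion `σ ∘ s_i = σ·s_i` if `σ(i) < σ(i+1)` and `σ ∘ s_i = σ` otherwise. -/
def heckeProd (w : List ℤ) : Equiv.Perm ℤ :=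
  w.foldl (fun σ i => if σ i < σ (i + 1) then σ * sPerm i else σ) 1

/-- `s_{a_n} ∘ ⋯ ∘ s_{a_2} ∘ s_{a_1} ∘ s_{a_2} ∘ ⋯ ∘ s_{a_n}` for `a = a_1 a_2 ⋯ a_n`. -/
def invHecke (a : List ℤ) : Equiv.Perm ℤ := heckeProd (a.reverse ++ a.tail)

/-- Membership in `I_ℤ`: a finitely supported involution of `ℤ`. -/
def IZ (z : Equiv.Perm ℤ) : Prop := {x : ℤ | z x ≠ x}.Finite ∧ z * z = 1

/-- The set of involution words of `z`. -/
def Rinv (z : Equiv.Perm ℤ) : Set (List ℤ) :=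
  {a | invHecke a = z ∧ ∀ b : List ℤ, invHecke b = z → a.length ≤ b.length}

/-- 0-based index `k` is a commutation in the word `a` (this corresponds to the 1-based
index `k+1`): `a_{k+1}` and `a_{k+1} + 1` are both fixed points of
`s_{a_k} ∘ ⋯ ∘ s_{a_1} ∘ ⋯ ∘ s_{a_k}`. -/
def IsCommutation (a : List ℤ) (k : ℕ) : Prop :=
  ∃ x, a[k]? = some x ∧ invHecke (a.take k) x = x ∧ invHecke (a.take k) (x + 1) = x + 1

/-- The set of primed involution words of `z`. -/
def RinvPlus (z : Equiv.Perm ℤ) : Set PWord :=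
  {a | unprimeWord a ∈ Rinv z ∧
     ∀ (k : ℕ) (x : Letter), a[k]? = some x → x.primed = true →
       IsCommutation (unprimeWord a) k}

/-! ## Shifted tableaux.
A shifted tableau is recorded as its list of rows, from the first (bottom) row upward;
the entry at 0-based index `k` of 0-based row `r` occupies the box in row `r+1` and
column `r+1+k` of the shifted diagram. -/

abbrev STab := List (List Letter)

/-- A strict partition, recorded as its (strictly decreasing) list of positive parts. -/
def IsStrictPartition (sh : List ℕ) : Prop :=
  List.Chain' (fun a b => b < a) sh ∧ ∀ m ∈ sh, 0 < m

def shapeOf {α : Type*} (T : List (List α)) : List ℕ := T.map List.length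

/-- The rows form the shifted diagram of a strict partition. -/
def IsShifted {α : Type*} (T : List (List α)) : Prop := IsStrictPartition (shapeOf T)

/-- The entry of `T` in (0-based) row `r` and column `c` of the shifted diagram. -/
def entryG? {α : Type*} (T : List (List α)) (r c : ℕ) : Option α :=
  if r ≤ c then (T[r]?).bind (fun row => row[c - r]?) else none

def entry? (T : STab) (r c : ℕ) : Option Letter := entryG? T r c

def setRowG {α : Type*} (T : List (List α)) (r : ℕ) (row : List α) : List (List α) :=
  if r < T.length then T.set r row else T ++ [row]

def setEntryG {α : Type*} (T : List (List α)) (r c : ℕ) (x : α) : List (List α) :=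
  T.set r ((T.getD r []).set (c - r) x)

def numCols {α : Type*} (T : List (List α)) : ℕ := (T.getD 0 []).length

/-- Row reading word: rows left to right, starting with the last (top) row. -/
def rowWord (T : STab) : PWord := T.reverse.flatten

/-- Column reading word: columns top to bottom, starting with the first column. -/
def colWord (T : STab) : PWord :=
  (List.range (numCols T)).flatMap (fun c =>
    ((List.range (c + 1)).reverse).filterMap (fun r => entry? T r c))

def unprimeT (T : STab) : STab := T.map (List.map Letter.unprime)

/-- Remove the primes from all main-diagonal entries. -/
def unprimeDiagT (T : STab) : STab :=
  T.map (fun row =>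
    match row with
    | [] => []
    | x :: rest => Letter.unprime x :: rest)

/-- Rows and columns are strictly increasing. -/
def IsIncreasing (T : STab) : Prop :=
  (∀ r c x y, entry? T r c = some x → entry? T r (c + 1) = some y → x < y) ∧
  (∀ r c x y, entry? T r c = some x → entry? T (r + 1) c = some y → x < y)

/-- No primed entries on the main diagonal. -/
def NoDiagPrimes (T : STab) : Prop :=
  ∀ r x, entry? T r r = some x → x.primed = false

/-- Entries positive, rows and columns weakly increasing, no primed entry repeated
in a row and no unprimed entry repeated in a column. -/
def IsSemistandard (T : STab) : Prop :=
  (∀ x ∈ T.flatten, 0 < x.ceil) ∧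
  (∀ r c x y, entry? T r c = some x → entry? T r (c + 1) = some y → x ≤ y) ∧
  (∀ r c x y, entry? T r c = some x → entry? T (r + 1) c = some y → x ≤ y) ∧
  (∀ r c c' x, c < c' → entry? T r c = some x → entry? T r c' = some x →
    x.primed = false) ∧
  (∀ r r' c x, r < r' → entry? T r c = some x → entry? T r' c = some x →
    x.primed = true)

/-- Increasing, with exactly one of `i` or `i'` as an entry for each `i = 1, …, n`,
where `n` is the number of boxes. -/
def IsStandard (T : STab) : Prop :=
  IsIncreasing T ∧
  ∀ i : ℤ, 1 ≤ i → i ≤ (T.flatten.length : ℤ) →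
    T.flatten.countP (fun x => decide (x.ceil = i)) = 1
/-! ## Orthogonal Edelman–Greene insertion -/

/-- "Switching the primes" of a pair: reverse the primes on both letters if exactly one
of them is unprimed, and leave them unchanged otherwise. -/
def switchPrimes (x y : Letter) : Letter × Letter :=
  if x.primed = y.primed then (x, y)
  else (⟨x.ceil, !x.primed⟩, ⟨y.ceil, !y.primed⟩)

/-- Column-insertion stage of orthogonal Edelman–Greene insertion:
insert letter `w` into column `c` of `T` (then continue into later columns). -/
def egCol : ℕ → STab → ℕ → Letter → STab × Bool
  | 0, T, _, _ => (T, true)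
  | fuel + 1, T, c, w =>
    let occ := (List.range (c + 1)).filterMap (fun r => (entry? T r c).map (fun x => (r, x)))
    match occ.findIdx? (fun p => decide (w.ceil < p.2.ceil)) with
    | none =>
        -- place `w` in the first empty box of the column
        let r := occ.length
        let w' := if r = c ∧ w.primed then Letter.unprime w else w
        (setRowG T r ((T.getD r []) ++ [w']), if r = c then w.primed else true)
    | some kM =>
        let km := (occ.findIdx? (fun p => decide (w.ceil ≤ p.2.ceil))).getD kM
        let im := (occ.getD km (0, default)).1
        let m := (occ.getD km (0, default)).2
        if km = kM then
          if im = c then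
            -- m = M on the main diagonal
            egCol fuel (setEntryG T im c (Letter.unprime w)) (c + 1) ⟨m.ceil, w.primed⟩
          else
            -- m = M off the main diagonal
            egCol fuel (setEntryG T im c w) (c + 1) m
        else
          -- m < M : switch the primes on m and M, insert w+1 into the next column
          let iM := (occ.getD kM (0, default)).1
          let M := (occ.getD kM (0, default)).2
          let p := switchPrimes m M
          egCol fuel (setEntryG (setEntryG T im c p.1) iM c p.2) (c + 1) (Letter.succL w)

/-- Row-insertion stage of orthogonal Edelman–Greene insertion:
insert letter `w` into row `r` of `T`. -/
def egRow : ℕ → STab → ℕ → Letter → STab × Bool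
  | 0, T, _, _ => (T, true)
  | fuel + 1, T, r, w =>
    let row := T.getD r []
    match row.findIdx? (fun x => decide (w.ceil < x.ceil)) with
    | none =>
        if row.isEmpty ∧ w.primed then (setRowG T r [Letter.unprime w], true)
        else (setRowG T r (row ++ [w]), false)
    | some kM =>
        let km := (row.findIdx? (fun x => decide (w.ceil ≤ x.ceil))).getD kM
        let m := row.getD km default
        if km = kM then
          if km = 0 then
            -- m = M on the main diagonal
            egCol fuel (setRowG T r (row.set 0 (Letter.unprime w))) (r + 1)
              ⟨m.ceil, w.primed⟩
          else
            -- m = M off the main diagonal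
            egRow fuel (setRowG T r (row.set km w)) (r + 1) m
        else
          -- m < M : switch primes; insert w+1 into the next column (if m is on the
          -- main diagonal) or the next row (otherwise)
          let M := row.getD kM default
          let p := switchPrimes m M
          let row' := (row.set km p.1).set kM p.2
          if km = 0 then egCol fuel (setRowG T r row') (r + 1) (Letter.succL w)
          else egRow fuel (setRowG T r row') (r + 1) (Letter.succL w)

/-- `T ←ᴼ u` together with the flag recording whether the insertion ended in
column insertion. -/
def egInsert (T : STab) (u : Letter) : STab × Bool :=
  egRow (T.flatten.length + T.length + 2) T 0 u

/-- The orthogonal Edelman–Greene insertion tableau `P_EGᴼ(a)`. -/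
def PEG (a : PWord) : STab := a.foldl (fun T u => (egInsert T u).1) []

/-- Add the recording letter `x` to `Q` in the unique box of `Pnew` not in `Pold`. -/
def addBox (Q Pold Pnew : STab) (x : Letter) : STab :=
  match (List.range Pnew.length).find?
      (fun r => decide ((Pold.getD r []).length ≠ (Pnew.getD r []).length)) with
  | some r => setRowG Q r ((Q.getD r []) ++ [x])
  | none => Q

def QEGaux : STab → STab → ℕ → PWord → STab
  | _, Q, _, [] => Q
  | P, Q, n, u :: rest =>
      let res := egInsert P u
      QEGaux res.1 (addBox Q P res.1 ⟨(n : ℤ), res.2⟩) (n + 1) rest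

/-- The orthogonal Edelman–Greene recording tableau `Q_EGᴼ(a)`. -/
def QEG (a : PWord) : STab := QEGaux [] [] 1 a

/-! ## Orthogonal Coxeter–Knuth operators -/

def ock1 (x : Letter) : Letter := ⟨x.ceil, !x.primed⟩

def ock2 (x y : Letter) : Letter × Letter := (⟨y.ceil, x.primed⟩, ⟨x.ceil, y.primed⟩)

def ock3 (x y z : Letter) : Letter × Letter × Letter :=
  if x.ceil = z.ceil ∧ (x.ceil - y.ceil = 1 ∨ y.ceil - x.ceil = 1) then
    if x.primed = false ∧ y.primed = false ∧ z.primed = false then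
      -- XYX ↔ YXY
      (⟨y.ceil, false⟩, ⟨x.ceil, false⟩, ⟨y.ceil, false⟩)
    else if x.primed = true ∧ y.primed = false ∧ z.primed = false then
      -- X'YX ↦ YXY'
      (⟨y.ceil, false⟩, ⟨x.ceil, false⟩, ⟨y.ceil, true⟩)
    else if x.primed = false ∧ y.primed = false ∧ z.primed = true then
      -- YXY' ↦ X'YX
      (⟨y.ceil, true⟩, ⟨x.ceil, false⟩, ⟨y.ceil, false⟩)
    else (x, y, z)
  else if (x.ceil < z.ceil ∧ z.ceil < y.ceil) ∨ (y.ceil < z.ceil ∧ z.ceil < x.ceil) then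
    -- ACB ↔ CAB
    (y, x, z)
  else if (y.ceil < x.ceil ∧ x.ceil < z.ceil) ∨ (z.ceil < x.ceil ∧ x.ceil < y.ceil) then
    -- BCA ↔ BAC
    (x, z, y)
  else (x, y, z)

/-- The operator `ock_i` for `i ∈ ℤ`. -/
def ockW (i : ℤ) (a : PWord) : PWord :=
  if i = -1 then
    match a with
    | [] => []
    | x :: rest => ock1 x :: rest
  else if i = 0 then
    match a with
    | x :: y :: rest => (ock2 x y).1 :: (ock2 x y).2 :: rest
    | _ => a
  else if 1 ≤ i ∧ i + 2 ≤ (a.length : ℤ) then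
    let k := (i - 1).toNat
    match a[k]?, a[k + 1]?, a[k + 2]? with
    | some x, some y, some z =>
        a.take k ++ [(ock3 x y z).1, (ock3 x y z).2.1, (ock3 x y z).2.2] ++ a.drop (k + 3)
    | _, _, _ => a
  else a

/-- Orthogonal Coxeter–Knuth equivalence: generated by `a ∼ ock_i(a)` for all `i ∈ ℤ`. -/
def OckEquiv : PWord → PWord → Prop :=
  Relation.EqvGen (fun a b => ∃ i : ℤ, b = ockW i a)
/-! ## Descents -/

/-- Descent set of a primed word (as a set of 1-based positions). -/
def DesWord (a : PWord) : Set ℤ :=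
  {i | ∃ k : ℕ, i = (k : ℤ) + 1 ∧ ∃ x y, a[k]? = some x ∧ a[k + 1]? = some y ∧ y < x}

/-- Descent set of a standard shifted tableau. -/
def DesT (T : STab) : Set ℤ :=
  {i | 0 < i ∧ (
    (∃ r c r' c', entry? T r c = some ⟨i, false⟩ ∧
        entry? T r' c' = some ⟨i + 1, false⟩ ∧ r < r') ∨
    (∃ r c r' c', entry? T r c = some ⟨i, true⟩ ∧
        entry? T r' c' = some ⟨i + 1, true⟩ ∧ c < c') ∨
    (∃ r c r' c', entry? T r c = some ⟨i, false⟩ ∧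
        entry? T r' c' = some ⟨i + 1, true⟩))}

/-! ## Dual equivalence operators on standard shifted tableaux -/

def numPrimes (T : STab) : ℕ := T.flatten.countP (fun x => x.primed)

/-- The entries of column `c`, read from bottom to top (increasing). -/
def colLetters (T : STab) (c : ℕ) : PWord :=
  (List.range (c + 1)).filterMap (fun r => entry? T r c)

/-- The shifted reading word `unprime(C_q R_q ⋯ C_1 R_1)`. -/
def shword (T : STab) : List ℤ :=
  (((List.range (numCols T)).reverse).flatMap (fun idx =>
    (colLetters T idx).filter (fun x => x.primed) ++
      ((T.getD idx []).filter (fun x => !x.primed)))).map Letter.ceil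

def idxOfZ (v : ℤ) : List ℤ → ℕ
  | [] => 0
  | x :: r => if x = v then 0 else idxOfZ v r + 1

def positionsOf (T : STab) : List (ℕ × ℕ) :=
  (List.range T.length).flatMap (fun r =>
    (List.range (T.getD r []).length).map (fun k => (r, r + k)))

/-- The box `□_v` of `T` containing `v` or `v'`. -/
def boxOf (T : STab) (v : ℤ) : Option (ℕ × ℕ) :=
  (positionsOf T).find? (fun p =>
    match entry? T p.1 p.2 with
    | some x => decide (x.ceil = v)
    | none => false)

/-- Reverse the prime of the entry in position `(r, c)`. -/
def togglePos (T : STab) (r c : ℕ) : STab :=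
  match entry? T r c with
  | some x => setEntryG T r c ⟨x.ceil, !x.primed⟩
  | none => T

/-- Switch the primes of the entries in the two given positions. -/
def switchAt (T : STab) (p q : ℕ × ℕ) : STab :=
  match entry? T p.1 p.2, entry? T q.1 q.2 with
  | some x, some y =>
      if x.primed = y.primed then T else togglePos (togglePos T p.1 p.2) q.1 q.2
  | _, _ => T

/-- The row index of `□_v` if it is a main-diagonal box. -/
def diagBox? (T : STab) (v : ℤ) : Option ℕ :=
  (boxOf T v).bind (fun p => if p.1 = p.2 then some p.1 else none)

def switchDiag (T T' : STab) (u v : ℤ) : STab :=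
  match diagBox? T u, diagBox? T v with
  | some r, some s => switchAt T' (r, r) (s, s)
  | _, _ => T'

/-- The operator `𝔰_i`. -/
def sOp (i : ℤ) (T : STab) : STab :=
  match boxOf T i, boxOf T (i + 1) with
  | some (r1, c1), some (r2, c2) =>
      if r1 ≠ r2 ∧ c1 ≠ c2 then
        -- swap i ↔ i+1 and i' ↔ (i+1)'
        setEntryG (setEntryG T r1 c1 ⟨i + 1, ((entry? T r1 c1).getD default).primed⟩)
          r2 c2 ⟨i, ((entry? T r2 c2).getD default).primed⟩
      else if r1 ≠ c1 ∧ r2 ≠ c2 then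
        -- same row or column, neither box diagonal: reverse both primes
        togglePos (togglePos T r1 c1) r2 c2
      else
        -- same row or column, one box diagonal
        let T1 := if r1 = c1 then togglePos T r2 c2 else togglePos T r1 c1
        let T2 :=
          if 1 ≤ i - 1 ∧ (diagBox? T (i - 1)).isSome ∧ (diagBox? T (i + 1)).isSome then
            switchDiag T T1 (i - 1) (i + 1)
          else T1
        if i + 2 ≤ (T.flatten.length : ℤ) ∧ (diagBox? T i).isSome ∧
            (diagBox? T (i + 2)).isSome then
          switchDiag T T2 i (i + 2)
        else T2
  | _, _ => T

def btwn (a m b : ℕ) : Prop := (a < m ∧ m < b) ∨ (b < m ∧ m < a)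

instance (a m b : ℕ) : Decidable (btwn a m b) := by unfold btwn; infer_instance

/-- The dual equivalence operator `𝔡_i` for `i ∈ ℤ`. -/
def dOp (i : ℤ) (T : STab) : STab :=
  if ¬(1 ≤ i + 2 ∧ i + 2 ≤ (T.flatten.length : ℤ)) then T
  else if i = -1 then togglePos T 0 0
  else if i = 0 then togglePos T 0 1
  else
    let w := shword T
    if btwn (idxOfZ i w) (idxOfZ (i + 2) w) (idxOfZ (i + 1) w) then sOp i T
    else if btwn (idxOfZ (i + 1) w) (idxOfZ i w) (idxOfZ (i + 2) w) then sOp (i + 1) T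
    else T

/-! ## Marked cycles -/

/-- The 2-cycles of `z`, as ordered pairs `(i, j)` with `i < j = z(i)`. -/
def cycSet (z : Equiv.Perm ℤ) : Set (ℤ × ℤ) := {p | p.1 < p.2 ∧ z p.1 = p.2}

/-- `s_{a_n} ⋯ s_{a_{k+2}} s_{a_{k+1}}` (ordinary product; 0-based index `k`). -/
def suffixPerm (a : List ℤ) (k : ℕ) : Equiv.Perm ℤ :=
  ((a.drop (k + 1)).reverse.map sPerm).prod

/-- `γ_{k+1}(a)` as an ordered pair (junk value `(0,0)` off the commutation set). -/
def gammaPair (a : List ℤ) (k : ℕ) : ℤ × ℤ :=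
  match a[k]? with
  | some x => (min (suffixPerm a k x) (suffixPerm a k (x + 1)),
               max (suffixPerm a k x) (suffixPerm a k (x + 1)))
  | none => (0, 0)
/-! ## Increasing factorization sequences and Schur Q-functions -/

/-- `Incr_∞(R_inv^+(z))`: sequences of weakly increasing primed words, all but
finitely many empty, whose concatenation is a primed involution word for `z`. -/
def IncrSeq (z : Equiv.Perm ℤ) : Set (ℕ → PWord) :=
  {φ | (∀ n, List.Chain' (· ≤ ·) (φ n)) ∧
    ∃ N, (∀ n, N ≤ n → φ n = []) ∧ ((List.range N).map φ).flatten ∈ RinvPlus z}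

/-- Least bound past which a sequence of words is empty. -/
noncomputable def seqBound (φ : ℕ → PWord) : ℕ := sInf {N | ∀ n, N ≤ n → φ n = []}

/-- The concatenation `a^1 a^2 ⋯` of a sequence of words. -/
noncomputable def concatSeq (φ : ℕ → PWord) : PWord :=
  ((List.range (seqBound φ)).map φ).flatten

/-- `ℓ(a^1) + ⋯ + ℓ(a^i)`. -/
def prefLen (φ : ℕ → PWord) (i : ℕ) : ℕ := (((List.range i).map φ).map List.length).sum

/-- The minimal `i ≥ 1` with `j ≤ ℓ(a^1) + ⋯ + ℓ(a^i)`. -/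
noncomputable def relabel (φ : ℕ → PWord) (j : ℤ) : ℤ :=
  ((sInf {i : ℕ | 1 ≤ i ∧ j ≤ (prefLen φ i : ℤ)} : ℕ) : ℤ)

/-- The semistandard recording tableau `Q_EGᴼ(φ)`. -/
noncomputable def QEGseq (φ : ℕ → PWord) : STab :=
  (QEG (concatSeq φ)).map (List.map (fun x => (⟨relabel φ x.ceil, x.primed⟩ : Letter)))

/-- The insertion tableau `P_EGᴼ(φ)`. -/
noncomputable def PEGseq (φ : ℕ → PWord) : STab := PEG (concatSeq φ)

/-- The Schur Q-function of a strict partition: the coefficient of the monomial with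
exponent vector `d` is the number of semistandard shifted tableaux `T` of the given
shape with `x^T = x^d`. -/
noncomputable def SchurQ (sh : List ℕ) : MvPowerSeries ℤ ℤ :=
  fun d => (({T : STab | shapeOf T = sh ∧ IsSemistandard T ∧
    ∀ i : ℤ, d i = T.flatten.countP (fun x => decide (x.ceil = i))} : Set STab).ncard : ℤ)

/-- `Q_z = Σ_{φ ∈ Incr_∞(R_inv^+(z))} x^φ`. -/
noncomputable def Qz (z : Equiv.Perm ℤ) : MvPowerSeries ℤ ℤ :=
  fun d => (({φ : ℕ → PWord | φ ∈ IncrSeq z ∧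
    (∀ i : ℕ, d ((i : ℤ) + 1) = (φ i).length) ∧
    (∀ j : ℤ, j ≤ 0 → d j = 0)} : Set (ℕ → PWord)).ncard : ℤ)

/-! ## Dominant involutions -/

/-- The shifted diagram `SD_λ ⊆ ℤ × ℤ` of a strict partition. -/
def SDset (sh : List ℕ) : Set (ℤ × ℤ) :=
  {p | ∃ i j : ℕ, 1 ≤ i ∧ i ≤ sh.length ∧ 1 ≤ j ∧ j ≤ sh.getD (i - 1) 0 ∧
    p.1 = (i : ℤ) ∧ p.2 = (i : ℤ) + (j : ℤ) - 1}

/-- The involution Rothe diagram `D̂(z) = {(i,j) : z(i) > j ≤ i < z(j)}`. -/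
def invRothe (z : Equiv.Perm ℤ) : Set (ℤ × ℤ) :=
  {p | p.2 < z p.1 ∧ p.2 ≤ p.1 ∧ p.1 < z p.2}

/-- The tableau `T_λ` with entry `i + j - 1` in box `(i, j)` of `SD_λ`. -/
def Tlam (sh : List ℕ) : STab :=
  (List.range sh.length).map (fun r =>
    (List.range (sh.getD r 0)).map (fun k =>
      (⟨2 * (r : ℤ) + (k : ℤ) + 1, false⟩ : Letter)))

/-- The permutation `i + m ↦ w(i) + m` (fixing everything outside `m + support`). -/
def shiftPerm (m : ℕ) (w : Equiv.Perm ℤ) : Equiv.Perm ℤ :=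
  (Equiv.addLeft (m : ℤ)).permCongr w

/-- `z ∈ S_m`: `z` fixes every point outside `[1, m]`. -/
def SupportedOn (z : Equiv.Perm ℤ) (m : ℕ) : Prop :=
  ∀ x : ℤ, x < 1 ∨ (m : ℤ) < x → z x = x
/-! ## Primed compatible sequences -/

/-- A primed compatible sequence, recorded as the list of its columns `(index; value)`. -/
def IsPrimedCompatible (φ : List (ℕ × Letter)) : Prop :=
  (∀ p ∈ φ, 0 < p.1 ∧ 0 < p.2.ceil) ∧
  List.Chain' (fun p q : ℕ × Letter => p.1 ≤ q.1 ∧ (p.1 = q.1 → p.2 ≤ q.2)) φ ∧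
  (∀ (k l : ℕ) (p : ℕ × Letter), k < l → φ[k]? = some p → φ[l]? = some p →
    p.2.primed = false)

def IsIndexStrict (φ : List (ℕ × Letter)) : Prop :=
  List.Chain' (fun p q : ℕ × Letter => p.1 < q.1) φ

/-! ## Sagan–Worley insertion (orthogonal and symplectic versions) -/

/-- Whether `u` bumps `v`: strict comparison when inserting an unprimed letter into a
row or a primed letter into a column, weak comparison otherwise. -/
def swBump (isRow : Bool) (u v : Letter) : Bool :=
  if (isRow && !u.primed) || (!isRow && u.primed) then decide (u < v) else decide (u ≤ v)

/-- Column stage of orthogonal Sagan–Worley insertion. -/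
def swColO : ℕ → STab → ℕ → Letter → STab × Bool
  | 0, T, _, _ => (T, true)
  | fuel + 1, T, c, u =>
    let occ := (List.range (c + 1)).filterMap (fun r => (entry? T r c).map (fun x => (r, x)))
    match occ.find? (fun p => swBump false u p.2) with
    | none =>
        let r := occ.length
        let u' := if r = c ∧ u.primed then Letter.unprime u else u
        (setRowG T r ((T.getD r []) ++ [u']), true)
    | some p =>
        if p.1 = c then
          if u.ceil = p.2.ceil then swColO fuel T (c + 1) (Letter.unprime p.2)
          else
            let q := switchPrimes u p.2
            swColO fuel (setEntryG T p.1 c q.1) (c + 1) q.2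
        else swColO fuel (setEntryG T p.1 c u) (c + 1) p.2

/-- Row stage of orthogonal Sagan–Worley insertion. -/
def swRowO : ℕ → STab → ℕ → Letter → STab × Bool
  | 0, T, _, _ => (T, true)
  | fuel + 1, T, r, u =>
    let row := T.getD r []
    match row.findIdx? (fun v => swBump true u v) with
    | none =>
        if row.isEmpty ∧ u.primed then (setRowG T r [Letter.unprime u], true)
        else (setRowG T r (row ++ [u]), false)
    | some k =>
        let v := row.getD k default
        if k = 0 then
          if u.ceil = v.ceil then swColO fuel T (r + 1) (Letter.unprime v)
          else
            let q := switchPrimes u v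
            swColO fuel (setRowG T r (row.set 0 q.1)) (r + 1) q.2
        else swRowO fuel (setRowG T r (row.set k u)) (r + 1) v

def swInsertO (T : STab) (u : Letter) : STab × Bool :=
  swRowO (T.flatten.length + T.length + 2) T 0 u

/-- Column stage of symplectic (original) Sagan–Worley insertion. -/
def swColSp : ℕ → STab → ℕ → Letter → STab × Bool
  | 0, T, _, _ => (T, true)
  | fuel + 1, T, c, u =>
    let occ := (List.range (c + 1)).filterMap (fun r => (entry? T r c).map (fun x => (r, x)))
    match occ.find? (fun p => swBump false u p.2) with
    | none => (setRowG T occ.length ((T.getD occ.length []) ++ [u]), true)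
    | some p =>
        if p.1 = c then
          if u.ceil = p.2.ceil then swColSp fuel T (c + 1) (Letter.unprime p.2)
          else swColSp fuel (setEntryG T p.1 c u) (c + 1) p.2
        else swColSp fuel (setEntryG T p.1 c u) (c + 1) p.2

/-- Row stage of symplectic (original) Sagan–Worley insertion. -/
def swRowSp : ℕ → STab → ℕ → Letter → STab × Bool
  | 0, T, _, _ => (T, true)
  | fuel + 1, T, r, u =>
    let row := T.getD r []
    match row.findIdx? (fun v => swBump true u v) with
    | none => (setRowG T r (row ++ [u]), false)
    | some k =>
        let v := row.getD k default
        if k = 0 then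
          if u.ceil = v.ceil then swColSp fuel T (r + 1) (Letter.unprime v)
          else swColSp fuel (setRowG T r (row.set 0 u)) (r + 1) v
        else swRowSp fuel (setRowG T r (row.set k u)) (r + 1) v

def swInsertSp (T : STab) (u : Letter) : STab × Bool :=
  swRowSp (T.flatten.length + T.length + 2) T 0 u

def PSWO (φ : List (ℕ × Letter)) : STab := φ.foldl (fun T p => (swInsertO T p.2).1) []

def PSWSp (φ : List (ℕ × Letter)) : STab := φ.foldl (fun T p => (swInsertSp T p.2).1) []

def QSWaux (ins : STab → Letter → STab × Bool) : STab → STab → List (ℕ × Letter) → STab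
  | _, Q, [] => Q
  | P, Q, p :: rest =>
      let res := ins P p.2
      QSWaux ins res.1 (addBox Q P res.1 ⟨(p.1 : ℤ), res.2⟩) rest

def QSWO (φ : List (ℕ × Letter)) : STab := QSWaux swInsertO [] [] φ

def QSWSp (φ : List (ℕ × Letter)) : STab := QSWaux swInsertSp [] [] φ

/-- Entry `A_{ij}` of the circled matrix of `φ` (forgetting the circles). -/
def cmEntry (φ : List (ℕ × Letter)) (i j : ℕ) : ℕ :=
  φ.countP (fun p => decide (p.1 = i ∧ p.2.ceil = (j : ℤ)))

/-! ## Shifted mixed insertion (orthogonal and symplectic versions) -/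

/-- Tableaux whose entries are signed letters `(ε, u)`, `ε ∈ {+, -}`
(`true` records the sign `-`). -/
abbrev MTab := List (List (Bool × Letter))

def extractO (U : MTab) : STab :=
  U.map (fun row =>
    match row with
    | [] => []
    | (e, x) :: rest => (if e then (⟨x.ceil, true⟩ : Letter) else x) :: rest.map Prod.snd)

def extractSp (U : MTab) : STab := U.map (List.map Prod.snd)

/-- One mixed insertion, of the pair `β` into row (`isCol = false`) or column
(`isCol = true`) number `idx`; returns the tableau and the added box. -/
def hmIns (sympl : Bool) : ℕ → MTab → Bool → ℕ → Bool × Letter → MTab × (ℕ × ℕ)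
  | 0, T, _, _, _ => (T, (0, 0))
  | fuel + 1, T, isCol, idx, β =>
    if isCol then
      let c := idx
      let occ := (List.range (c + 1)).filterMap
        (fun r => (entryG? T r c).map (fun x => (r, x)))
      match occ.find? (fun p => decide (β.2 < p.2.2)) with
      | none =>
          let r := occ.length
          (setRowG T r ((T.getD r []) ++ [β]), (r, c))
      | some p =>
          if p.1 = c then
            hmIns sympl fuel
              (setEntryG T p.1 c (if sympl then (p.2.1, β.2) else β)) true (c + 1)
              (if sympl then (β.1, ⟨p.2.2.ceil, true⟩) else (p.2.1, ⟨p.2.2.ceil, true⟩))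
          else
            hmIns sympl fuel (setEntryG T p.1 c (p.2.1, β.2)) p.2.2.primed
              (if p.2.2.primed then c + 1 else p.1 + 1) (β.1, p.2.2)
    else
      let r := idx
      let row := T.getD r []
      match row.findIdx? (fun p => decide (β.2 < p.2)) with
      | none => (setRowG T r (row ++ [β]), (r, r + row.length))
      | some k =>
          let q := row.getD k default
          if k = 0 then
            hmIns sympl fuel
              (setRowG T r (row.set 0 (if sympl then (q.1, β.2) else β))) true (r + 1)
              (if sympl then (β.1, ⟨q.2.ceil, true⟩) else (q.1, ⟨q.2.ceil, true⟩))
          else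
            hmIns sympl fuel (setRowG T r (row.set k (q.1, β.2))) q.2.primed
              (if q.2.primed then r + k + 1 else r + 1) (β.1, q.2)

def hmInsert (sympl : Bool) (T : MTab) (x : Letter) : MTab × (ℕ × ℕ) :=
  hmIns sympl (2 * T.flatten.length + 4) T false 0 (x.primed, ⟨x.ceil, false⟩)

def hmAuxCS (sympl : Bool) : MTab → STab → List (ℕ × Letter) → MTab × STab
  | U, Q, [] => (U, Q)
  | U, Q, p :: rest =>
      let res := hmInsert sympl U p.2
      let pos := res.2
      let sgn := ((entryG? res.1 pos.1 pos.2).map Prod.fst).getD false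
      let pr : Bool := if sympl then sgn else (decide (pos.1 ≠ pos.2) && sgn)
      hmAuxCS sympl res.1
        (setRowG Q pos.1 ((Q.getD pos.1 []) ++ [(⟨(p.1 : ℤ), pr⟩ : Letter)])) rest

def PHMO (φ : List (ℕ × Letter)) : STab := extractO (hmAuxCS false [] [] φ).1
def QHMO (φ : List (ℕ × Letter)) : STab := (hmAuxCS false [] [] φ).2
def PHMSp (φ : List (ℕ × Letter)) : STab := extractSp (hmAuxCS true [] [] φ).1
def QHMSp (φ : List (ℕ × Letter)) : STab := (hmAuxCS true [] [] φ).2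

/-- A primed word, identified with the primed compatible sequence with
index row `1, 2, …, n`. -/
def wordCS (a : PWord) : List (ℕ × Letter) :=
  ((List.range a.length).zip a).map (fun p => (p.1 + 1, p.2))

/-! ## The transpose of a primed compatible sequence -/

def insSortedCS (p : ℕ × Letter) : List (ℕ × Letter) → List (ℕ × Letter)
  | [] => [p]
  | q :: rest =>
      if p.1 < q.1 ∨ (p.1 = q.1 ∧ p.2 ≤ q.2) then p :: q :: rest
      else q :: insSortedCS p rest

def sortCS (l : List (ℕ × Letter)) : List (ℕ × Letter) := l.foldr insSortedCS []

/-- `φ^⊤`: move each prime from the value to the index above it, interchange the two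
rows, and reorder the columns lexicographically. -/
def transposeCS (φ : List (ℕ × Letter)) : List (ℕ × Letter) :=
  sortCS (φ.map (fun p => (p.2.ceil.toNat, (⟨(p.1 : ℤ), p.2.primed⟩ : Letter))))

/-! ## The 0-Hecke action and the monoid of words -/

/-- The operator `σ ↦ σ ∘ s_i` for the Demazure product. -/
def demazure (i : ℤ) (σ : Equiv.Perm ℤ) : Equiv.Perm ℤ :=
  if σ i < σ (i + 1) then σ * sPerm i else σ

theorem mul_sPerm_left (σ : Equiv.Perm ℤ) (i : ℤ) : (σ * sPerm i) i = σ (i + 1) := by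
  simp [sPerm]

theorem mul_sPerm_right (σ : Equiv.Perm ℤ) (i : ℤ) : (σ * sPerm i) (i + 1) = σ i := by
  simp [sPerm]

theorem mul_sPerm_of_ne (σ : Equiv.Perm ℤ) {i j : ℤ} (h : j ≠ i) (h' : j ≠ i + 1) :
    (σ * sPerm i) j = σ j := by
  simp [sPerm, Equiv.swap_apply_of_ne_of_ne h h']

theorem demazure_idem (i : ℤ) (σ : Equiv.Perm ℤ) :
    demazure i (demazure i σ) = demazure i σ := by
  by_cases h : σ i < σ (i + 1)
  · have h1 : demazure i σ = σ * sPerm i := if_pos h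
    rw [h1, demazure, mul_sPerm_left, mul_sPerm_right, if_neg h.le.not_gt]
  · have h1 : demazure i σ = σ := if_neg h
    rw [h1, h1]

theorem sPerm_mul_comm {i j : ℤ} (h : i + 2 ≤ j) : sPerm i * sPerm j = sPerm j * sPerm i := by
  apply Equiv.Perm.Disjoint.commute
  intro x
  by_cases hx : x = i ∨ x = i + 1
  · right; exact Equiv.swap_apply_of_ne_of_ne (by omega) (by omega)
  · left; exact Equiv.swap_apply_of_ne_of_ne (by tauto) (by tauto)

theorem demazure_comm {i j : ℤ} (h : i + 2 ≤ j) (σ : Equiv.Perm ℤ) :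
    demazure i (demazure j σ) = demazure j (demazure i σ) := by
  have e1 := mul_sPerm_of_ne σ (i := j) (j := i) (by omega) (by omega)
  have e2 := mul_sPerm_of_ne σ (i := j) (j := i + 1) (by omega) (by omega)
  have e3 := mul_sPerm_of_ne σ (i := i) (j := j) (by omega) (by omega)
  have e4 := mul_sPerm_of_ne σ (i := i) (j := j + 1) (by omega) (by omega)
  unfold demazure
  by_cases h1 : σ i < σ (i + 1) <;> by_cases h2 : σ j < σ (j + 1) <;>
    simp only [h1, h2, if_true, if_false, e1, e2, e3, e4]
  rw [mul_assoc, mul_assoc, sPerm_mul_comm h]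

theorem sPerm_braid (i : ℤ) :
    sPerm i * sPerm (i + 1) * sPerm i = sPerm (i + 1) * sPerm i * sPerm (i + 1) := by
  ext x
  simp only [sPerm, Equiv.Perm.mul_apply, Equiv.swap_apply_def]
  split_ifs <;> omega

theorem demazure_braid (i : ℤ) (σ : Equiv.Perm ℤ) :
    demazure i (demazure (i + 1) (demazure i σ)) =
      demazure (i + 1) (demazure i (demazure (i + 1) σ)) := by
  have l := fun τ : Equiv.Perm ℤ => mul_sPerm_left τ i
  have m := fun τ : Equiv.Perm ℤ => mul_sPerm_right τ i
  have r := fun τ : Equiv.Perm ℤ =>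
    mul_sPerm_of_ne τ (i := i) (j := i + 1 + 1) (by omega) (by omega)
  have l' := fun τ : Equiv.Perm ℤ =>
    mul_sPerm_of_ne τ (i := i + 1) (j := i) (by omega) (by omega)
  have m' := fun τ : Equiv.Perm ℤ => mul_sPerm_left τ (i + 1)
  have r' := fun τ : Equiv.Perm ℤ => mul_sPerm_right τ (i + 1)
  have b : σ * sPerm i * sPerm (i + 1) * sPerm i =
      σ * sPerm (i + 1) * sPerm i * sPerm (i + 1) := by
    simpa only [mul_assoc] using congrArg (σ * ·) (sPerm_braid i)
  have n1 : σ i ≠ σ (i + 1) := σ.injective.ne (by omega)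
  have n2 : σ i ≠ σ (i + 1 + 1) := σ.injective.ne (by omega)
  have n3 : σ (i + 1) ≠ σ (i + 1 + 1) := σ.injective.ne (by omega)
  unfold demazure
  rcases lt_or_gt_of_ne n1 with h1 | h1 <;> rcases lt_or_gt_of_ne n2 with h2 | h2 <;>
    rcases lt_or_gt_of_ne n3 with h3 | h3 <;>
    first
    | (exfalso; omega)
    | simp only [h1, h2, h3, h1.not_gt, h2.not_gt, h3.not_gt, if_true, if_false,
        l, m, r, l', m', r', b]

def demazureEnd (i : ℤ) : Function.End (Equiv.Perm ℤ) := demazure i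

/-- Pairs of opposite operators on permutations, together with a length. -/
abbrev WordOp : Type :=
  (Function.End (Equiv.Perm ℤ))ᵐᵒᵖ × Function.End (Equiv.Perm ℤ) × Multiplicative ℕ

def genOp (i : ℤ) : WordOp :=
  (MulOpposite.op (demazureEnd i), demazureEnd i, Multiplicative.ofAdd 1)

/-- The monoid of words modulo having the same length and acting in the same way by the
Demazure product, read forwards as well as backwards. -/
abbrev WordMonoid : Type := MonoidHom.mrange (FreeMonoid.lift genOp)

namespace WordMonoid

def gen (i : ℤ) : WordMonoid :=
  ⟨genOp i, FreeMonoid.of i, FreeMonoid.lift_eval_of _ _⟩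

/-- The class of a word. -/
def ofWord (a : List ℤ) : WordMonoid := (a.map gen).prod

def len (x : WordMonoid) : ℕ := Multiplicative.toAdd x.1.2.2

/-- `s_{a_n} ∘ ⋯ ∘ s_{a_1} ∘ s_{a_1} ∘ ⋯ ∘ s_{a_n}` for the class of `a_1 ⋯ a_n`. -/
def inv (x : WordMonoid) : Equiv.Perm ℤ := x.1.1.unop (x.1.2.1 1)

theorem len_mul (x y : WordMonoid) : len (x * y) = len x + len y := rfl

theorem len_gen (i : ℤ) : len (gen i) = 1 := rfl

theorem len_ofWord (a : List ℤ) : len (ofWord a) = a.length := by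
  induction a with
  | nil => rfl
  | cons i a ih =>
    rw [ofWord, List.map_cons, List.prod_cons, len_mul, len_gen, ← ofWord, ih, List.length_cons,
      add_comm]

theorem ofWord_cons (i : ℤ) (b : List ℤ) : ofWord (i :: b) = gen i * ofWord b := by
  simp [ofWord]

theorem exists_ofWord (x : WordMonoid) : ∃ a, ofWord a = x := by
  obtain ⟨_, a, rfl⟩ := x
  refine ⟨a.toList, Subtype.ext ?_⟩
  simp only [ofWord, SubmonoidClass.coe_list_prod, List.map_map, FreeMonoid.lift_apply]
  rfl

theorem ofWord_fwd (a : List ℤ) (σ : Equiv.Perm ℤ) :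
    (ofWord a).1.1.unop σ = a.foldl (fun σ i => demazure i σ) σ := by
  induction a generalizing σ with
  | nil => rfl
  | cons i a ih => rw [ofWord_cons, List.foldl_cons, ← ih]; rfl

theorem ofWord_bwd (a : List ℤ) (σ : Equiv.Perm ℤ) :
    (ofWord a).1.2.1 σ = a.reverse.foldl (fun σ i => demazure i σ) σ := by
  induction a generalizing σ with
  | nil => rfl
  | cons i a ih =>
    rw [ofWord_cons, List.reverse_cons, List.foldl_append, ← ih]; rfl

theorem inv_ofWord (a : List ℤ) : inv (ofWord a) = invHecke a := by
  change _ = (a.reverse ++ a.tail).foldl (fun σ i => demazure i σ) 1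
  rw [inv, ofWord_fwd, ofWord_bwd, List.foldl_append]
  cases a with
  | nil => rfl
  | cons i a => simp [demazure_idem]

theorem gen_comm {i j : ℤ} (h : i + 2 ≤ j ∨ j + 2 ≤ i) : Commute (gen i) (gen j) := by
  have key : ∀ {i j : ℤ}, i + 2 ≤ j → gen i * gen j = gen j * gen i := by
    intro i j h
    have e : demazureEnd i * demazureEnd j = demazureEnd j * demazureEnd i :=
      funext fun σ => demazure_comm h σ
    refine Subtype.ext (Prod.ext ?_ (Prod.ext e rfl))
    exact congrArg MulOpposite.op e.symm
  rcases h with h | h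
  · exact key h
  · exact (key h).symm

theorem gen_braid (i : ℤ) :
    gen i * gen (i + 1) * gen i = gen (i + 1) * gen i * gen (i + 1) := by
  have e : demazureEnd i * demazureEnd (i + 1) * demazureEnd i =
      demazureEnd (i + 1) * demazureEnd i * demazureEnd (i + 1) :=
    funext fun σ => demazure_braid i σ
  exact Subtype.ext (Prod.ext (congrArg MulOpposite.op e) (Prod.ext e rfl))

/-- Equivalence of initial segments of involution words. -/
def InvEq (x y : WordMonoid) : Prop :=
  len x = len y ∧ ∀ t, inv (x * t) = inv (y * t)

theorem InvEq.refl (x : WordMonoid) : InvEq x x := ⟨rfl, fun _ => rfl⟩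

theorem InvEq.symm {x y : WordMonoid} (h : InvEq x y) : InvEq y x :=
  ⟨h.1.symm, fun t => (h.2 t).symm⟩

theorem InvEq.trans {x y z : WordMonoid} (h : InvEq x y) (h' : InvEq y z) : InvEq x z :=
  ⟨h.1.trans h'.1, fun t => (h.2 t).trans (h'.2 t)⟩

theorem InvEq.mul_right {x y : WordMonoid} (h : InvEq x y) (t : WordMonoid) :
    InvEq (x * t) (y * t) :=
  ⟨by rw [len_mul, len_mul, h.1], fun s => by rw [mul_assoc, mul_assoc]; exact h.2 _⟩

/-- The first two letters of an involution word may be exchanged. -/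
theorem invEq_swap_adjacent (i : ℤ) : InvEq (gen i * gen (i + 1)) (gen (i + 1) * gen i) := by
  refine ⟨rfl, fun t => ?_⟩
  change t.1.1.unop (demazure (i + 1) (demazure i (demazure i (demazure (i + 1) (t.1.2.1 1))))) =
    t.1.1.unop (demazure i (demazure (i + 1) (demazure (i + 1) (demazure i (t.1.2.1 1)))))
  rw [demazure_idem, demazure_idem, demazure_braid]

theorem invEq_swap {i j : ℤ} (h : i < j) : InvEq (gen i * gen j) (gen j * gen i) := by
  rcases eq_or_lt_of_le (show i + 1 ≤ j from h) with rfl | h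
  · exact invEq_swap_adjacent i
  · rw [(gen_comm (Or.inl (by omega))).eq]; exact InvEq.refl _

/-- `x` is the class of an involution word. -/
def Reduced (x : WordMonoid) : Prop := ∀ y, inv y = inv x → len x ≤ len y

theorem reduced_ofWord {z : Equiv.Perm ℤ} {a : List ℤ} (h : a ∈ Rinv z) :
    Reduced (ofWord a) := by
  intro y hy
  obtain ⟨b, rfl⟩ := exists_ofWord y
  rw [inv_ofWord, inv_ofWord] at hy
  rw [len_ofWord, len_ofWord]
  exact h.2 b (hy.trans h.1)

theorem InvEq.reduced {x y t : WordMonoid} (h : InvEq x y) (hx : Reduced (x * t)) :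
    Reduced (y * t) := by
  intro s hs
  have := hx s (hs.trans (h.2 t).symm)
  rwa [len_mul, h.1, ← len_mul] at this

theorem not_reduced_square (x t : WordMonoid) (i : ℤ) :
    ¬ Reduced (x * gen i * gen i * t) := by
  intro h
  have e : inv (x * gen i * t) = inv (x * gen i * gen i * t) := by
    change t.1.1.unop (demazure i (x.1.1.unop (x.1.2.1 (demazure i (t.1.2.1 1))))) =
      t.1.1.unop (demazure i (demazure i (x.1.1.unop (x.1.2.1 (demazure i (demazure i
        (t.1.2.1 1)))))))
    rw [demazure_idem, demazure_idem]
  have := h _ e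
  simp only [len_mul, len_gen] at this
  omega

end WordMonoid

/-! ## Increasing fillings of shifted diagrams and their reading words -/

/-- Products of two arrangements of a list agree if the factors whose order differs commute. -/
theorem List.Perm.prod_map_eq_of_pairwise {α M : Type*} [Monoid M] (f : α → M)
    {R R' : α → α → Prop} {l l' : List α} (hp : l.Perm l')
    (hl : l.Pairwise R) (hl' : l'.Pairwise R')
    (h : ∀ a ∈ l, ∀ b ∈ l, R a b → R' b a → Commute (f a) (f b)) :
    (l.map f).prod = (l'.map f).prod := by
  induction l' generalizing l with
  | nil => rw [hp.eq_nil]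
  | cons y t ih =>
    obtain ⟨p, q, rfl⟩ := List.append_of_mem (hp.mem_iff.2 List.mem_cons_self)
    have hp' : (p ++ q).Perm t := (List.perm_middle.symm.trans hp).cons_inv
    rw [List.pairwise_append, List.pairwise_cons] at hl
    rw [List.pairwise_cons] at hl'
    have hc : Commute (f y) (p.map f).prod := by
      apply Commute.list_prod_right
      intro x hx
      obtain ⟨a, ha, rfl⟩ := List.mem_map.1 hx
      refine (h a (by simp [ha]) y (by simp) (hl.2.2 a ha y (by simp)) (hl'.1 a ?_)).symm
      exact hp'.mem_iff.1 (by simp [ha])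
    have ih' := ih hp' (List.pairwise_append.2 ⟨hl.1, hl.2.1.2,
        fun a ha b hb => hl.2.2 a ha b (List.mem_cons_of_mem _ hb)⟩) hl'.2
      (fun a ha b hb => h a (by simp at ha ⊢; tauto) b (by simp at hb ⊢; tauto))
    rw [List.map_cons, List.prod_cons, ← ih']
    simp only [List.map_append, List.map_cons, List.prod_append, List.prod_cons]
    rw [← mul_assoc, ← mul_assoc, hc.eq]

/-- A partial filling of the boxes `(r, c)` (row, column) by integers. -/
abbrev Filling : Type := ℕ × ℕ → Option ℤ

namespace Filling

open WordMonoid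

/-- The filling is an increasing tableau of finite shifted shape. -/
structure Increasing (E : Filling) : Prop where
  diag : ∀ {r c v}, E (r, c) = some v → r ≤ c
  row : ∀ {r c v}, E (r, c + 1) = some v → r ≤ c → ∃ u, E (r, c) = some u ∧ u < v
  col : ∀ {r c v}, E (r + 1, c) = some v → ∃ u, E (r, c) = some u ∧ u < v
  finite : {p | E p ≠ none}.Finite

namespace Increasing

variable {E : Filling}

theorem row_le (hE : E.Increasing) {r c v} (k : ℕ) (h : E (r, c + k) = some v) (hr : r ≤ c) :
    ∃ u, E (r, c) = some u ∧ u + k ≤ v := by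
  induction k generalizing v with
  | zero => exact ⟨v, h, by simp⟩
  | succ k ih =>
    obtain ⟨u, hu, huv⟩ := hE.row h (hr.trans (Nat.le_add_right c k))
    obtain ⟨u', hu', h'⟩ := ih hu
    exact ⟨u', hu', by push_cast; omega⟩

theorem col_le (hE : E.Increasing) {r c v} (k : ℕ) (h : E (r + k, c) = some v) :
    ∃ u, E (r, c) = some u ∧ u + k ≤ v := by
  induction k generalizing v with
  | zero => exact ⟨v, h, by simp⟩
  | succ k ih =>
    obtain ⟨u, hu, huv⟩ := hE.col h
    obtain ⟨u', hu', h'⟩ := ih hu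
    exact ⟨u', hu', by push_cast; omega⟩

theorem le (hE : E.Increasing) {r c r' c' v} (h : E (r', c') = some v) (hr : r ≤ r')
    (hc : c ≤ c') (hrc : r ≤ c) :
    ∃ u, E (r, c) = some u ∧ u + (r' - r : ℕ) + (c' - c : ℕ) ≤ v := by
  obtain ⟨u, hu, huv⟩ := hE.col_le (r := r) (r' - r) (by rwa [Nat.add_sub_cancel' hr])
  obtain ⟨u', hu', h'⟩ := hE.row_le (c := c) (c' - c) (by rwa [Nat.add_sub_cancel' hc]) hrc
  exact ⟨u', hu', by omega⟩

/-- Comparison of two entries in weakly south-west to north-east position. -/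
theorem add_le (hE : E.Increasing) {r c r' c' u v} (h : E (r', c') = some v)
    (h' : E (r, c) = some u) (hr : r ≤ r') (hc : c ≤ c') :
    u + (r' - r : ℕ) + (c' - c : ℕ) ≤ v := by
  obtain ⟨u', hu', h''⟩ := hE.le h hr hc (hE.diag h')
  rw [h'] at hu'
  cases hu'
  exact h''

end Increasing

/-- `l` lists the occupied boxes in `S`, each box after all boxes weakly to its north-west. -/
def IsReading (E : Filling) (S : Set (ℕ × ℕ)) (l : List (ℕ × ℕ)) : Prop :=
  l.Pairwise (fun p q => ¬(p.1 ≤ q.1 ∧ q.2 ≤ p.2)) ∧ ∀ p, p ∈ l ↔ p ∈ S ∧ E p ≠ none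

/-- The letter in an occupied box. -/
def letter (E : Filling) (p : ℕ × ℕ) : WordMonoid := gen ((E p).getD 0)

theorem Increasing.exists_isReading {E : Filling} (hE : E.Increasing) (S : Set (ℕ × ℕ)) :
    ∃ l, E.IsReading S l := by
  classical
  have hf : (S ∩ {p | E p ≠ none}).Finite := hE.finite.subset Set.inter_subset_right
  let le : ℕ × ℕ → ℕ × ℕ → Bool := fun p q => decide (q.1 < p.1 ∨ (p.1 = q.1 ∧ p.2 ≤ q.2))
  refine ⟨hf.toFinset.toList.mergeSort le, ?_, fun p => by simp⟩
  have h1 : (hf.toFinset.toList.mergeSort le).Pairwise (fun p q => le p q) :=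
    List.pairwise_mergeSort (by simp only [le, decide_eq_true_eq]; omega)
      (by simp only [le, Bool.or_eq_true, decide_eq_true_eq]; omega) _
  have h2 : (hf.toFinset.toList.mergeSort le).Nodup :=
    (List.mergeSort_perm _ _).nodup_iff.2 (Finset.nodup_toList _)
  refine (h1.and h2).imp ?_
  rintro ⟨a, b⟩ ⟨c, d⟩ ⟨h, h'⟩ h''
  simp only [le, decide_eq_true_eq, ne_eq, Prod.mk.injEq] at h h' h''
  omega

open Classical in
/-- The class of the reading words of the part of the filling inside `S`. -/
noncomputable def word (E : Filling) (S : Set (ℕ × ℕ)) : WordMonoid :=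
  if h : ∃ l, E.IsReading S l then (h.choose.map E.letter).prod else 1

theorem IsReading.nodup {E : Filling} {S : Set (ℕ × ℕ)} {l : List (ℕ × ℕ)}
    (h : E.IsReading S l) : l.Nodup := by
  refine h.1.imp ?_
  rintro a _ h rfl
  exact h ⟨le_rfl, le_rfl⟩

namespace Increasing

variable {E E' : Filling} {S A B : Set (ℕ × ℕ)}

theorem word_eq (hE : E.Increasing) {l : List (ℕ × ℕ)} (hl : E.IsReading S l) :
    E.word S = (l.map E.letter).prod := by
  have h : ∃ l, E.IsReading S l := ⟨l, hl⟩
  rw [word, dif_pos h]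
  have hc := h.choose_spec
  have hp : h.choose.Perm l := (List.perm_ext_iff_of_nodup hc.nodup hl.nodup).2
    fun p => (hc.2 p).trans (hl.2 p).symm
  refine hp.prod_map_eq_of_pairwise _ hc.1 hl.1 ?_
  rintro ⟨r, c⟩ hp ⟨r', c'⟩ hq hpq hqp
  obtain ⟨v, hv⟩ := Option.ne_none_iff_exists'.1 ((hc.2 _).1 hp).2
  obtain ⟨v', hv'⟩ := Option.ne_none_iff_exists'.1 ((hc.2 _).1 hq).2
  have d := hE.diag hv
  have d' := hE.diag hv'
  dsimp only at hpq hqp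
  simp only [letter, hv, hv', Option.getD_some]
  apply gen_comm
  rcases le_total r r' with hr | hr
  · have := hE.add_le hv' hv hr (by omega)
    omega
  · have := hE.add_le hv hv' hr (by omega)
    omega

theorem word_congr (hE : E.Increasing) (hE' : E'.Increasing)
    (h : ∀ p v, (p ∈ A ∧ E p = some v) ↔ (p ∈ B ∧ E' p = some v)) :
    E.word A = E'.word B := by
  obtain ⟨l, hl⟩ := hE.exists_isReading A
  have hl' : E'.IsReading B l := by
    refine ⟨hl.1, fun p => (hl.2 p).trans ?_⟩
    have := h p
    simp only [Option.ne_none_iff_exists', ← exists_and_left]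
    exact exists_congr this
  rw [hE.word_eq hl, hE'.word_eq hl']
  congr 1
  refine List.map_congr_left fun p hp => ?_
  obtain ⟨hA, hn⟩ := (hl.2 p).1 hp
  obtain ⟨v, hv⟩ := Option.ne_none_iff_exists'.1 hn
  rw [letter, letter, hv, ((h p v).1 ⟨hA, hv⟩).2]

theorem word_split (hE : E.Increasing)
    (h : ∀ r c v, E (r, c) = some v → ((r, c) ∈ S ↔ (r, c) ∈ A ∨ (r, c) ∈ B))
    (h' : ∀ r c r' c' v v', E (r, c) = some v → E (r', c') = some v' →
      (r, c) ∈ A → (r', c') ∈ B → r ≤ r' → c' ≤ c → False) :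
    E.word S = E.word A * E.word B := by
  obtain ⟨l, hl⟩ := hE.exists_isReading A
  obtain ⟨l', hl'⟩ := hE.exists_isReading B
  have : E.IsReading S (l ++ l') := by
    refine ⟨List.pairwise_append.2 ⟨hl.1, hl'.1, ?_⟩, ?_⟩
    · rintro ⟨r, c⟩ hp ⟨r', c'⟩ hq ⟨h1, h2⟩
      obtain ⟨hA, hn⟩ := (hl.2 _).1 hp
      obtain ⟨hB, hn'⟩ := (hl'.2 _).1 hq
      obtain ⟨v, hv⟩ := Option.ne_none_iff_exists'.1 hn
      obtain ⟨v', hv'⟩ := Option.ne_none_iff_exists'.1 hn'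
      exact h' _ _ _ _ _ _ hv hv' hA hB h1 h2
    · rintro ⟨r, c⟩
      rw [List.mem_append, hl.2, hl'.2, ← or_and_right]
      refine and_congr_left fun hn => ?_
      obtain ⟨v, hv⟩ := Option.ne_none_iff_exists'.1 hn
      exact (h _ _ _ hv).symm
  rw [hE.word_eq this, hE.word_eq hl, hE.word_eq hl', List.map_append, List.prod_append]

theorem word_singleton (hE : E.Increasing) {r c : ℕ} {v : ℤ} (hv : E (r, c) = some v)
    (h : ∀ r' c' v', E (r', c') = some v' → ((r', c') ∈ S ↔ r' = r ∧ c' = c)) :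
    E.word S = gen v := by
  have : E.IsReading S [(r, c)] := by
    refine ⟨List.pairwise_singleton _ _, ?_⟩
    rintro ⟨r', c'⟩
    rw [List.mem_singleton, Prod.mk.injEq]
    constructor
    · rintro ⟨rfl, rfl⟩
      exact ⟨(h _ _ _ hv).2 ⟨rfl, rfl⟩, by simp [hv]⟩
    · rintro ⟨hS, hn⟩
      obtain ⟨v', hv'⟩ := Option.ne_none_iff_exists'.1 hn
      exact (h _ _ _ hv').1 hS
  rw [hE.word_eq this]
  simp [letter, hv]

theorem word_empty (hE : E.Increasing) (h : ∀ r c v, E (r, c) = some v → (r, c) ∉ S) :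
    E.word S = 1 := by
  have : E.IsReading S [] := by
    refine ⟨List.Pairwise.nil, ?_⟩
    rintro ⟨r, c⟩
    simp only [List.not_mem_nil, false_iff, not_and]
    intro hS hn
    obtain ⟨v, hv⟩ := Option.ne_none_iff_exists'.1 hn
    exact h _ _ _ hv hS
  rw [hE.word_eq this]
  simp

theorem gen_commute_word (hE : E.Increasing) {a : ℤ}
    (h : ∀ r c v, E (r, c) = some v → (r, c) ∈ S → v + 2 ≤ a ∨ a + 2 ≤ v) :
    Commute (gen a) (E.word S) := by
  obtain ⟨l, hl⟩ := hE.exists_isReading S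
  rw [hE.word_eq hl]
  apply Commute.list_prod_right
  intro x hx
  obtain ⟨⟨r, c⟩, hp, rfl⟩ := List.mem_map.1 hx
  obtain ⟨hS, hn⟩ := (hl.2 _).1 hp
  obtain ⟨v, hv⟩ := Option.ne_none_iff_exists'.1 hn
  rw [letter, hv]
  exact gen_comm (h _ _ _ hv hS).symm

/-! ### Cutting along rows and columns -/

theorem word_rows_ge (hE : E.Increasing) (r : ℕ) :
    E.word {p | r ≤ p.1} = E.word {p | r + 1 ≤ p.1} * E.word {p | p.1 = r} := by
  apply hE.word_split <;> simp only [Set.mem_ofPred_eq] <;> intros <;> omega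

theorem word_rows_lt (hE : E.Increasing) (r : ℕ) :
    E.word {p | p.1 < r + 1} = E.word {p | p.1 = r} * E.word {p | p.1 < r} := by
  apply hE.word_split <;> simp only [Set.mem_ofPred_eq] <;> intros <;> omega

theorem word_rows (hE : E.Increasing) (r : ℕ) :
    E.word Set.univ = E.word {p | r + 1 ≤ p.1} * E.word {p | p.1 = r} * E.word {p | p.1 < r} := by
  rw [← hE.word_rows_ge]
  apply hE.word_split <;> simp only [Set.mem_ofPred_eq, Set.mem_univ, true_iff] <;> intros <;> omega

theorem word_cols_ge (hE : E.Increasing) (c : ℕ) :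
    E.word {p | c ≤ p.2} = E.word {p | p.2 = c} * E.word {p | c + 1 ≤ p.2} := by
  apply hE.word_split <;> simp only [Set.mem_ofPred_eq] <;> intros <;> omega

theorem word_cols_lt (hE : E.Increasing) (c : ℕ) :
    E.word {p | p.2 < c + 1} = E.word {p | p.2 < c} * E.word {p | p.2 = c} := by
  apply hE.word_split <;> simp only [Set.mem_ofPred_eq] <;> intros <;> omega

theorem word_cols (hE : E.Increasing) (c : ℕ) :
    E.word Set.univ = E.word {p | p.2 < c} * E.word {p | p.2 = c} * E.word {p | c + 1 ≤ p.2} := by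
  rw [mul_assoc, ← hE.word_cols_ge]
  apply hE.word_split <;> simp only [Set.mem_ofPred_eq, Set.mem_univ, true_iff] <;> intros <;> omega

theorem word_row (hE : E.Increasing) {r b : ℕ} {m : ℤ} (hm : E (r, b) = some m) :
    E.word {p | p.1 = r} =
      E.word {p | p.1 = r ∧ p.2 < b} * gen m * E.word {p | p.1 = r ∧ b < p.2} := by
  rw [← hE.word_singleton (S := {p | p.1 = r ∧ p.2 = b}) hm
      (by simp only [Set.mem_ofPred_eq, implies_true]),
    ← hE.word_split (S := {p | p.1 = r ∧ p.2 ≤ b})]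
  · apply hE.word_split <;> simp only [Set.mem_ofPred_eq] <;> intros <;> omega
  all_goals simp only [Set.mem_ofPred_eq]; intros; omega

theorem word_col (hE : E.Increasing) {b c : ℕ} {m : ℤ} (hm : E (b, c) = some m) :
    E.word {p | p.2 = c} =
      E.word {p | p.2 = c ∧ b < p.1} * gen m * E.word {p | p.2 = c ∧ p.1 < b} := by
  rw [← hE.word_singleton (S := {p | p.1 = b ∧ p.2 = c}) hm
      (by simp only [Set.mem_ofPred_eq, implies_true]),
    ← hE.word_split (S := {p | p.2 = c ∧ b ≤ p.1})]
  · apply hE.word_split <;> simp only [Set.mem_ofPred_eq] <;> intros <;> omega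
  all_goals simp only [Set.mem_ofPred_eq]; intros; omega

end Increasing

/-- Write the letter `w` into the box `p`. -/
def put (E : Filling) (p : ℕ × ℕ) (w : ℤ) : Filling := Function.update E p (some w)

theorem put_self (E : Filling) (p : ℕ × ℕ) (w : ℤ) : E.put p w p = some w :=
  Function.update_self _ _ _

theorem put_of_ne (E : Filling) {p q : ℕ × ℕ} (w : ℤ) (h : q ≠ p) : E.put p w q = E q :=
  Function.update_of_ne h _ _

theorem put_eq_some (E : Filling) {r c r' c' : ℕ} {v w : ℤ} :
    E.put (r, c) w (r', c') = some v ↔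
      (r' = r ∧ c' = c ∧ v = w) ∨ (¬(r' = r ∧ c' = c) ∧ E (r', c') = some v) := by
  by_cases h : r' = r ∧ c' = c
  · obtain ⟨rfl, rfl⟩ := h
    rw [put_self]
    simp [eq_comm]
  · rw [put_of_ne E w (by simpa using h)]
    tauto

namespace Increasing

variable {E : Filling}

theorem put (hE : E.Increasing) {r c : ℕ} {w : ℤ} (hrc : r ≤ c)
    (left : ∀ c', c = c' + 1 → r ≤ c' → ∃ u, E (r, c') = some u ∧ u < w)
    (right : ∀ v, E (r, c + 1) = some v → w < v)
    (below : ∀ r', r = r' + 1 → ∃ u, E (r', c) = some u ∧ u < w)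
    (above : ∀ v, E (r + 1, c) = some v → w < v) :
    (E.put (r, c) w).Increasing where
  diag := by
    intro r' c' v hv
    rcases E.put_eq_some.1 hv with ⟨rfl, rfl, -⟩ | ⟨-, h⟩
    · exact hrc
    · exact hE.diag h
  row := by
    intro r' c' v hv hr
    rcases E.put_eq_some.1 hv with ⟨rfl, rfl, rfl⟩ | ⟨hn, h⟩
    · obtain ⟨u, hu, huv⟩ := left c' rfl hr
      exact ⟨u, E.put_eq_some.2 (Or.inr ⟨by omega, hu⟩), huv⟩
    · by_cases h' : r' = r ∧ c' = c
      · obtain ⟨rfl, rfl⟩ := h'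
        exact ⟨w, E.put_self _ _, right v h⟩
      · obtain ⟨u, hu, huv⟩ := hE.row h hr
        exact ⟨u, E.put_eq_some.2 (Or.inr ⟨h', hu⟩), huv⟩
  col := by
    intro r' c' v hv
    rcases E.put_eq_some.1 hv with ⟨rfl, rfl, rfl⟩ | ⟨hn, h⟩
    · obtain ⟨u, hu, huv⟩ := below r' rfl
      exact ⟨u, E.put_eq_some.2 (Or.inr ⟨by omega, hu⟩), huv⟩
    · by_cases h' : r' = r ∧ c' = c
      · obtain ⟨rfl, rfl⟩ := h'
        exact ⟨w, E.put_self _ _, above v h⟩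
      · obtain ⟨u, hu, huv⟩ := hE.col h
        exact ⟨u, E.put_eq_some.2 (Or.inr ⟨h', hu⟩), huv⟩
  finite := by
    refine (hE.finite.insert (r, c)).subset ?_
    intro p hp
    by_cases h : p = (r, c)
    · exact Or.inl h
    · exact Or.inr (by simpa [put_of_ne E w h] using hp)

theorem word_put (hE : E.Increasing) {p : ℕ × ℕ} {w : ℤ} (hE' : (E.put p w).Increasing)
    {S : Set (ℕ × ℕ)} (hS : p ∉ S) : (E.put p w).word S = E.word S := by
  apply hE'.word_congr hE
  intro q v
  refine and_congr_right fun hq => ?_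
  rw [put_of_ne]
  rintro rfl
  exact hS hq

/-- Entries of a row (a column) strictly increase. -/
theorem lt_of_row (hE : E.Increasing) {r c c' : ℕ} {u v : ℤ} (h : E (r, c) = some u)
    (h' : E (r, c') = some v) (hc : c < c') : u < v := by
  have := hE.add_le h' h le_rfl hc.le
  omega

theorem lt_of_col (hE : E.Increasing) {r r' c : ℕ} {u v : ℤ} (h : E (r, c) = some u)
    (h' : E (r', c) = some v) (hr : r < r') : u < v := by
  have := hE.add_le h' h hr.le le_rfl
  omega

/-! ### Row insertion -/

theorem row_bump (hE : E.Increasing) {r b : ℕ} {w m : ℤ} (hE' : (E.put (r, b) w).Increasing)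
    (hm : E (r, b) = some m) (hw : w < m) (hlt : ∀ c v, c < b → E (r, c) = some v → v < w) :
    E.word {p | p.1 = r} * gen w = gen m * (E.put (r, b) w).word {p | p.1 = r} := by
  rw [hE.word_row hm, hE'.word_row (E.put_self _ _), hE.word_put hE' (by simp),
    hE.word_put hE' (by simp)]
  have h1 : Commute (gen w) (E.word {p | p.1 = r ∧ b < p.2}) := by
    apply hE.gen_commute_word
    rintro _ c v hv ⟨rfl, hc⟩
    have := hE.lt_of_row hm hv hc
    omega
  have h2 : Commute (gen m) (E.word {p | p.1 = r ∧ p.2 < b}) := by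
    apply hE.gen_commute_word
    rintro _ c v hv ⟨rfl, hc⟩
    have := hlt c v hc hv
    omega
  simp only [mul_assoc]
  rw [← h1.eq, ← mul_assoc, ← h2.eq]
  simp only [mul_assoc]

theorem row_switch (hE : E.Increasing) {r b : ℕ} {w : ℤ}
    (hm : E (r, b) = some w) (hM : E (r, b + 1) = some (w + 1)) :
    E.word {p | p.1 = r} * gen w = gen (w + 1) * E.word {p | p.1 = r} := by
  have e : E.word {p | p.1 = r ∧ b < p.2} =
      gen (w + 1) * E.word {p | p.1 = r ∧ b + 1 < p.2} := by
    rw [← hE.word_singleton (S := {p | p.1 = r ∧ p.2 = b + 1}) hM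
      (by simp only [Set.mem_ofPred_eq, implies_true])]
    apply hE.word_split <;> simp only [Set.mem_ofPred_eq] <;> intros <;> omega
  rw [hE.word_row hm, e]
  have h1 : Commute (gen w) (E.word {p | p.1 = r ∧ b + 1 < p.2}) := by
    apply hE.gen_commute_word
    rintro _ c v hv ⟨rfl, hc⟩
    have := hE.lt_of_row hM hv hc
    omega
  have h2 : Commute (gen (w + 1)) (E.word {p | p.1 = r ∧ p.2 < b}) := by
    apply hE.gen_commute_word
    rintro _ c v hv ⟨rfl, hc⟩
    have := hE.lt_of_row hv hm hc
    omega
  have h3 := gen_braid w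
  simp only [mul_assoc] at h3 ⊢
  rw [← h1.eq, ← mul_assoc (gen (w + 1)) (E.word _), h2.eq]
  simp only [mul_assoc]
  rw [← mul_assoc (gen (w + 1)) (gen w), ← mul_assoc (gen w), h3]
  simp only [mul_assoc]

theorem row_consecutive (hE : E.Increasing) {r b : ℕ} {w : ℤ} {x t : WordMonoid}
    (hm : E (r, b) = some w) (h : Reduced (x * (E.word {p | p.1 = r} * gen w) * t)) :
    E (r, b + 1) = some (w + 1) := by
  by_contra hM
  have h1 : Commute (gen w) (E.word {p | p.1 = r ∧ b < p.2}) := by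
    apply hE.gen_commute_word
    rintro _ c v hv ⟨rfl, hc⟩
    obtain ⟨u, hu, -⟩ := hE.le (c := b + 1) hv le_rfl hc ((hE.diag hm).trans (Nat.le_succ b))
    have h1 := hE.lt_of_row hm hu (Nat.lt_succ_self b)
    have h2 := hE.add_le hv hu le_rfl hc
    have h3 : u ≠ w + 1 := by rintro rfl; exact hM hu
    omega
  rw [hE.word_row hm, mul_assoc _ (E.word {p | p.1 = r ∧ b < p.2}), ← h1.eq] at h
  simp only [← mul_assoc] at h
  rw [mul_assoc _ (E.word {p | p.1 = r ∧ b < p.2})] at h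
  exact not_reduced_square _ _ _ h

/-! ### Column insertion -/

theorem col_bump (hE : E.Increasing) {b c : ℕ} {w m : ℤ} (hE' : (E.put (b, c) w).Increasing)
    (hm : E (b, c) = some m) (hw : w < m) (hlt : ∀ r v, r < b → E (r, c) = some v → v < w) :
    gen w * E.word {p | p.2 = c} = (E.put (b, c) w).word {p | p.2 = c} * gen m := by
  rw [hE.word_col hm, hE'.word_col (E.put_self _ _), hE.word_put hE' (by simp),
    hE.word_put hE' (by simp)]
  have h1 : Commute (gen w) (E.word {p | p.2 = c ∧ b < p.1}) := by
    apply hE.gen_commute_word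
    rintro r _ v hv ⟨rfl, hc⟩
    have := hE.lt_of_col hm hv hc
    omega
  have h2 : Commute (gen m) (E.word {p | p.2 = c ∧ p.1 < b}) := by
    apply hE.gen_commute_word
    rintro r _ v hv ⟨rfl, hc⟩
    have := hlt r v hc hv
    omega
  rw [mul_assoc _ (gen m), h2.eq, ← mul_assoc, ← mul_assoc, h1.eq, mul_assoc]

theorem word_col_above (hE : E.Increasing) {b c : ℕ} {w : ℤ} (hM : E (b + 1, c) = some w) :
    E.word {p | p.2 = c ∧ b < p.1} = E.word {p | p.2 = c ∧ b + 1 < p.1} * gen w := by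
  rw [← hE.word_singleton (S := {p | p.1 = b + 1 ∧ p.2 = c}) hM
    (by simp only [Set.mem_ofPred_eq, implies_true])]
  apply hE.word_split <;> simp only [Set.mem_ofPred_eq] <;> intros <;> omega

theorem col_switch (hE : E.Increasing) {b c : ℕ} {w : ℤ}
    (hm : E (b, c) = some w) (hM : E (b + 1, c) = some (w + 1)) :
    gen w * E.word {p | p.2 = c} = E.word {p | p.2 = c} * gen (w + 1) := by
  rw [hE.word_col hm, hE.word_col_above hM]
  have h1 : Commute (gen w) (E.word {p | p.2 = c ∧ b + 1 < p.1}) := by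
    apply hE.gen_commute_word
    rintro r _ v hv ⟨rfl, hc⟩
    have := hE.lt_of_col hM hv hc
    omega
  have h2 : Commute (gen (w + 1)) (E.word {p | p.2 = c ∧ p.1 < b}) := by
    apply hE.gen_commute_word
    rintro r _ v hv ⟨rfl, hc⟩
    have := hE.lt_of_col hv hm hc
    omega
  have h3 := gen_braid w
  simp only [mul_assoc] at h3 ⊢
  rw [← h2.eq, ← mul_assoc, h1.eq]
  simp only [mul_assoc]
  rw [← mul_assoc (gen (w + 1)) (gen w), ← mul_assoc (gen w), h3]
  simp only [mul_assoc]

theorem col_consecutive (hE : E.Increasing) {b c : ℕ} {w : ℤ} {x t : WordMonoid}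
    (hm : E (b, c) = some w) (h : Reduced (x * (gen w * E.word {p | p.2 = c}) * t)) :
    E (b + 1, c) = some (w + 1) := by
  by_contra hM
  have h1 : Commute (gen w) (E.word {p | p.2 = c ∧ b < p.1}) := by
    apply hE.gen_commute_word
    rintro r _ v hv ⟨rfl, hc⟩
    have hr := hE.diag hv
    obtain ⟨u, hu, -⟩ := hE.le (r := b + 1) hv hc le_rfl (by omega)
    have h1 := hE.lt_of_col hm hu (Nat.lt_succ_self b)
    have h2 := hE.add_le hv hu hc le_rfl
    have h3 : u ≠ w + 1 := by rintro rfl; exact hM hu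
    omega
  rw [hE.word_col hm] at h
  simp only [← mul_assoc] at h
  rw [mul_assoc x, h1.eq] at h
  simp only [← mul_assoc] at h
  rw [mul_assoc] at h
  exact not_reduced_square _ _ _ h

/-! ### Passing from rows to columns at the main diagonal -/

theorem diag_row (hE : E.Increasing) {r : ℕ} {m : ℤ} (hm : E (r, r) = some m) :
    E.word {p | p.1 = r} = gen m * E.word {p | p.1 = r ∧ r < p.2} := by
  rw [hE.word_row hm, hE.word_empty, one_mul]
  rintro _ c v hv ⟨rfl, hc⟩
  have := hE.diag hv
  omega

theorem word_rows_lt_diag (hE : E.Increasing) (r : ℕ) :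
    E.word {p | p.1 < r} = E.word {p | p.1 < r ∧ p.2 ≤ r} * E.word {p | p.1 < r ∧ r < p.2} := by
  apply hE.word_split <;> simp only [Set.mem_ofPred_eq] <;> intros <;> omega

theorem word_cols_lt_diag (hE : E.Increasing) {r : ℕ} {m : ℤ} (hm : E (r, r) = some m) :
    E.word {p | p.2 < r + 1} = gen m * E.word {p | p.1 < r ∧ p.2 ≤ r} := by
  rw [← hE.word_singleton (S := {p | p.1 = r ∧ p.2 = r}) hm
    (by simp only [Set.mem_ofPred_eq, implies_true])]
  apply hE.word_split <;> simp only [Set.mem_ofPred_eq]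
  · intro a b v hv
    have := hE.diag hv
    omega
  · intros; omega

theorem word_cols_ge_diag (hE : E.Increasing) (r : ℕ) :
    E.word {p | r + 1 ≤ p.2} = E.word {p | r + 1 ≤ p.1} * E.word {p | p.1 = r ∧ r < p.2} *
      E.word {p | p.1 < r ∧ r < p.2} := by
  rw [← hE.word_split (S := {p | r ≤ p.1 ∧ r < p.2})]
  · apply hE.word_split <;> simp only [Set.mem_ofPred_eq] <;> intros <;> omega
  · simp only [Set.mem_ofPred_eq]
    intro a b v hv
    have := hE.diag hv
    omega
  · simp only [Set.mem_ofPred_eq]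
    intros
    omega

theorem corner_commute (hE : E.Increasing) (r : ℕ) :
    Commute (E.word {p | p.1 < r ∧ p.2 ≤ r})
      (E.word {p | r + 1 ≤ p.1} * E.word {p | p.1 = r ∧ r < p.2}) := by
  have e : E.word {p | r ≤ p.1 ∧ r < p.2} =
      E.word {p | r + 1 ≤ p.1} * E.word {p | p.1 = r ∧ r < p.2} := by
    apply hE.word_split <;> simp only [Set.mem_ofPred_eq]
    · intro a b v hv
      have := hE.diag hv
      omega
    · intros; omega
  rw [← e]
  refine Eq.trans (b := E.word {p | (p.1 < r ∧ p.2 ≤ r) ∨ (r ≤ p.1 ∧ r < p.2)}) ?_ ?_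
  · symm
    apply hE.word_split <;> simp only [Set.mem_ofPred_eq, implies_true]
    intros
    omega
  · apply hE.word_split <;> simp only [Set.mem_ofPred_eq] <;> intros <;> omega

theorem gen_commute_corner (hE : E.Increasing) {r : ℕ} {m a : ℤ} (hm : E (r, r) = some m)
    (ha : m < a) : Commute (gen a) (E.word {p | p.1 < r ∧ p.2 ≤ r}) := by
  apply hE.gen_commute_word
  rintro i j v hv ⟨hi, hj⟩
  have := hE.add_le hm hv hi.le hj
  omega

theorem gen_commute_above (hE : E.Increasing) {r : ℕ} {m a : ℤ} (hm : E (r, r) = some m)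
    (ha : a ≤ m) : Commute (gen a) (E.word {p | r + 1 ≤ p.1}) := by
  apply hE.gen_commute_word
  rintro i j v hv hi
  have := hE.diag hv
  simp only [Set.mem_ofPred_eq] at hi
  have := hE.add_le hv hm (by omega) (by omega)
  omega

theorem diag_bump (hE : E.Increasing) {r : ℕ} {w m : ℤ} (hE' : (E.put (r, r) w).Increasing)
    (hm : E (r, r) = some m) (hw : w < m) :
    InvEq (E.word {p | r ≤ p.1} * gen w * E.word {p | p.1 < r})
      ((E.put (r, r) w).word {p | p.2 < r + 1} * gen m *
        (E.put (r, r) w).word {p | r + 1 ≤ p.2}) := by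
  have hlt : ∀ c v, c < r → E (r, c) = some v → v < w := by
    intro c v hc hv
    have := hE.diag hv
    omega
  have c1 := (hE.gen_commute_above hm hw.le).eq
  have c2 := (hE.gen_commute_above hm le_rfl).eq
  have c3 := hE.corner_commute r
  have c4 := hE'.gen_commute_corner (E.put_self _ _) hw
  rw [hE.word_put hE' (by simp)] at c4
  rw [hE.word_rows_ge, mul_assoc _ (E.word {p | p.1 = r}), hE.row_bump hE' hm hw hlt,
    hE'.diag_row (E.put_self _ _), hE'.word_cols_lt_diag (E.put_self _ _), hE.word_rows_lt_diag,
    hE.word_put hE' (by simp), hE.word_put hE' (by simp), hE.word_put hE' (by simp),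
    hE.word_cols_ge_diag]
  set U := E.word {p | r + 1 ≤ p.1}
  set Y := E.word {p | p.1 = r ∧ r < p.2}
  set L := E.word {p | p.1 < r ∧ p.2 ≤ r}
  set D := E.word {p | p.1 < r ∧ r < p.2}
  have e1 : U * (gen m * (gen w * Y)) * (L * D) = gen m * gen w * (U * Y * L * D) := by
    simp only [← mul_assoc]
    rw [← c2, mul_assoc (gen m) U, ← c1]
    simp only [mul_assoc]
  have e2 : gen w * L * gen m * (U * Y * D) = gen w * gen m * (U * Y * L * D) := by
    rw [mul_assoc (gen w) L, ← c4.eq, ← c3.eq]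
    simp only [mul_assoc]
  rw [e1, e2]
  exact (invEq_swap hw).symm.mul_right _

/-- The words `321 2` and `123 2` are equivalent as initial segments of involution words. -/
theorem _root_.WordMonoid.invEq_staircase (w : ℤ) :
    InvEq (gen (w + 2) * gen (w + 1) * gen w * gen (w + 1))
      (gen w * gen (w + 1) * gen (w + 2) * gen (w + 1)) := by
  have c := (gen_comm (i := w) (j := w + 2) (Or.inl le_rfl)).eq
  have b := gen_braid w
  have b' := gen_braid (w + 1)
  rw [show w + 1 + 1 = w + 2 by ring] at b'
  have s := (invEq_swap (show w + 1 < w + 2 by omega)).symm.mul_right (gen w * gen (w + 1))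
  have s' := (invEq_swap (show w < w + 1 by omega)).mul_right (gen (w + 2) * gen (w + 1))
  have e : gen (w + 1) * gen (w + 2) * (gen w * gen (w + 1)) =
      gen (w + 1) * gen w * (gen (w + 2) * gen (w + 1)) := by
    simp only [mul_assoc]
    rw [← mul_assoc (gen (w + 2)) (gen w), ← c]
    simp only [mul_assoc]
  rw [e] at s
  simp only [mul_assoc] at s s' ⊢
  exact s.trans s'.symm

theorem diag_switch (hE : E.Increasing) {r : ℕ} {w : ℤ} {t : WordMonoid}
    (hm : E (r, r) = some w) (hM : E (r, r + 1) = some (w + 1))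
    (h : Reduced (E.word {p | r ≤ p.1} * gen w * E.word {p | p.1 < r} * t)) :
    InvEq (E.word {p | r ≤ p.1} * gen w * E.word {p | p.1 < r})
      (E.word {p | p.2 < r + 1} * gen (w + 1) * E.word {p | r + 1 ≤ p.2}) := by
  have c1 := (hE.gen_commute_above hm le_rfl).eq
  have c3 := hE.corner_commute r
  have c4 := hE.gen_commute_corner hm (show w < w + 1 by omega)
  have hY : E.word {p | p.1 = r ∧ r < p.2} =
      gen (w + 1) * E.word {p | p.1 = r ∧ r + 1 < p.2} := by
    rw [← hE.word_singleton (S := {p | p.1 = r ∧ p.2 = r + 1}) hM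
      (by simp only [Set.mem_ofPred_eq, implies_true])]
    apply hE.word_split <;> simp only [Set.mem_ofPred_eq] <;> intros <;> omega
  rw [hE.word_rows_ge, mul_assoc _ (E.word {p | p.1 = r}), hE.row_switch hm hM,
    hE.diag_row hm, hE.word_rows_lt_diag] at h ⊢
  rw [hE.word_cols_lt_diag hm, hE.word_cols_ge_diag]
  rw [hY] at c3 h ⊢
  set U := E.word {p | r + 1 ≤ p.1} with hU
  set Y := E.word {p | p.1 = r ∧ r + 1 < p.2}
  set L := E.word {p | p.1 < r ∧ p.2 ≤ r}
  set D := E.word {p | p.1 < r ∧ r < p.2}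
  have h2 : E (r + 1, r + 1) = some (w + 2) := by
    by_contra hn
    have c2 : Commute (gen (w + 1)) U := by
      apply hE.gen_commute_word
      rintro i j v hv hi
      simp only [Set.mem_ofPred_eq] at hi
      have hd := hE.diag hv
      obtain ⟨u, hu, -⟩ := hE.le hv hi (hi.trans hd) le_rfl
      have h1 := hE.lt_of_col hM hu (Nat.lt_succ_self r)
      have h2 := hE.add_le hv hu hi (hi.trans hd)
      have h3 : u ≠ w + 2 := by rintro rfl; exact hn hu
      omega
    have e : U * (gen (w + 1) * (gen w * (gen (w + 1) * Y))) * (L * D) * t =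
        gen (w + 1) * gen w * (gen (w + 1) * U * Y * (L * D) * t) := by
      simp only [← mul_assoc]
      rw [← c2.eq, mul_assoc _ U, ← c1]
      simp only [← mul_assoc]
      rw [mul_assoc _ U, ← c2.eq]
      simp only [← mul_assoc]
    rw [e] at h
    have h' := (invEq_swap (show w < w + 1 by omega)).symm.reduced h
    simp only [← mul_assoc] at h'
    rw [mul_assoc _ U, mul_assoc _ (U * Y), mul_assoc _ (U * Y * L),
      mul_assoc _ (U * Y * L * D)] at h'
    exact not_reduced_square _ _ _ h'
  have hU' : U = E.word {p | r + 1 + 1 ≤ p.1} *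
      (gen (w + 2) * E.word {p | p.1 = r + 1 ∧ r + 1 < p.2}) := by
    rw [hU, hE.word_rows_ge, hE.diag_row h2]
  have d0 := (hE.gen_commute_above h2 (show w ≤ w + 2 by omega)).eq
  have d1 := (hE.gen_commute_above h2 (show w + 1 ≤ w + 2 by omega)).eq
  have d2 := (hE.gen_commute_above h2 le_rfl).eq
  have z : ∀ a, a ≤ w + 1 → Commute (gen a) (E.word {p | p.1 = r + 1 ∧ r + 1 < p.2}) := by
    intro a ha
    apply hE.gen_commute_word
    rintro i j v hv ⟨rfl, hj⟩
    have := hE.lt_of_row h2 hv hj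
    omega
  have z0 := (z w (by omega)).eq
  have z1 := (z (w + 1) le_rfl).eq
  rw [hU'] at c3 ⊢
  set V := E.word {p | r + 1 + 1 ≤ p.1}
  set Z := E.word {p | p.1 = r + 1 ∧ r + 1 < p.2}
  have e1 : V * (gen (w + 2) * Z) * (gen (w + 1) * (gen w * (gen (w + 1) * Y))) * (L * D) =
      gen (w + 2) * gen (w + 1) * gen w * gen (w + 1) * (V * Z * Y * L * D) := by
    simp only [← mul_assoc]
    rw [← d2]
    simp only [mul_assoc]
    rw [← mul_assoc Z, ← z1]
    simp only [mul_assoc]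
    rw [← mul_assoc Z, ← z0]
    simp only [mul_assoc]
    rw [← mul_assoc Z, ← z1]
    simp only [mul_assoc]
    rw [← mul_assoc V, ← d1]
    simp only [mul_assoc]
    rw [← mul_assoc V, ← d0]
    simp only [mul_assoc]
    rw [← mul_assoc V, ← d1]
    simp only [mul_assoc]
  have e2 : gen w * L * gen (w + 1) * (V * (gen (w + 2) * Z) * (gen (w + 1) * Y) * D) =
      gen w * gen (w + 1) * gen (w + 2) * gen (w + 1) * (V * Z * Y * L * D) := by
    rw [mul_assoc (gen w) L, ← c4.eq]
    simp only [mul_assoc] at c3 ⊢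
    have c3' := congrArg (· * D) c3.eq
    simp only [mul_assoc] at c3'
    rw [c3', ← mul_assoc V (gen (w + 2)), ← d2]
    simp only [mul_assoc]
    rw [← mul_assoc Z (gen (w + 1)), ← z1]
    simp only [mul_assoc]
    rw [← mul_assoc V (gen (w + 1)), ← d1]
    simp only [mul_assoc]
  rw [e1, e2]
  exact (invEq_staircase w).mul_right _

end Increasing

/-! ## The states of an insertion -/

/-- The word read off while `w` is about to be inserted into row `r`. -/
noncomputable def rowStateWord (E : Filling) (r : ℕ) (w : ℤ) : WordMonoid :=
  E.word {p | r ≤ p.1} * gen w * E.word {p | p.1 < r}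

/-- The word read off while `w` is about to be inserted into column `c`. -/
noncomputable def colStateWord (E : Filling) (c : ℕ) (w : ℤ) : WordMonoid :=
  E.word {p | p.2 < c} * gen w * E.word {p | c ≤ p.2}

/-- `w` may be inserted into row `r`: either `r` is the first row, or `w` comes from a box of the
previous row. -/
structure RowState (E : Filling) (r : ℕ) (w : ℤ) : Prop where
  increasing : E.Increasing
  origin : ∀ r₀, r = r₀ + 1 → ∃ b, r ≤ b ∧ E (r₀, b) ≠ none ∧
    (∀ j v, j ≤ b → E (r₀, j) = some v → v < w) ∧ ∀ v, E (r, b) = some v → w ≤ v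

/-- `w` may be inserted into column `c`, having been bumped from a box of the previous column. -/
structure ColState (E : Filling) (c : ℕ) (w : ℤ) : Prop where
  increasing : E.Increasing
  origin : ∃ c₀ b, c = c₀ + 1 ∧ E (b, c₀) ≠ none ∧
    (∀ j v, j ≤ b → E (j, c₀) = some v → v < w) ∧ ∀ v, E (b, c) = some v → w ≤ v

theorem put_eq_self {E : Filling} {p : ℕ × ℕ} {w : ℤ} (h : E p = some w) : E.put p w = E := by
  rw [put, ← h, Function.update_eq_self]

namespace RowState

variable {E : Filling} {r b : ℕ} {w m : ℤ}

theorem put_increasing (h : E.RowState r w) (hm : E (r, b) = some m) (hw : w < m)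
    (hlt : ∀ j v, j < b → E (r, j) = some v → v < w) : (E.put (r, b) w).Increasing := by
  have hE := h.increasing
  apply hE.put (hE.diag hm)
  · rintro c' rfl hr
    obtain ⟨u, hu, -⟩ := hE.row hm hr
    exact ⟨u, hu, hlt _ _ (Nat.lt_succ_self _) hu⟩
  · intro v hv
    exact hw.trans (hE.lt_of_row hm hv (Nat.lt_succ_self _))
  · rintro r' rfl
    obtain ⟨u, hu, -⟩ := hE.col hm
    obtain ⟨b₀, hb, -, h1, h2⟩ := h.origin r' rfl
    refine ⟨u, hu, h1 b u ?_ hu⟩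
    by_contra hn
    obtain ⟨v, hv, -⟩ := hE.le hm le_rfl (le_of_not_ge hn) hb
    have := h2 v hv
    have := hlt _ v (not_le.1 hn) hv
    omega
  · intro v hv
    exact hw.trans (hE.lt_of_col hm hv (Nat.lt_succ_self _))

theorem bump (h : E.RowState r w) (hm : E (r, b) = some m) (hw : w < m)
    (hlt : ∀ j v, j < b → E (r, j) = some v → v < w) (hb : r < b) :
    (E.put (r, b) w).RowState (r + 1) m where
  increasing := h.put_increasing hm hw hlt
  origin := by
    rintro r₀ hr
    obtain rfl : r = r₀ := by omega
    refine ⟨b, hb, by rw [put_self]; exact Option.some_ne_none _, ?_, ?_⟩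
    · intro j v hj hv
      rcases E.put_eq_some.1 hv with ⟨-, -, rfl⟩ | ⟨hn, hv⟩
      · exact hw
      · exact (hlt j v (by omega) hv).trans hw
    · intro v hv
      rw [put_of_ne _ _ (by simp)] at hv
      exact (h.increasing.lt_of_col hm hv (Nat.lt_succ_self _)).le

theorem bump_diag (h : E.RowState r w) (hm : E (r, r) = some m) (hw : w < m) :
    (E.put (r, r) w).ColState (r + 1) m := by
  have hE := h.increasing
  have hE' := h.put_increasing hm hw (fun j v hj hv => by have := hE.diag hv; omega)
  refine ⟨hE', r, r, rfl, by rw [put_self]; exact Option.some_ne_none _, ?_, ?_⟩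
  · intro j v hj hv
    have := hE'.add_le (E.put_self (r, r) w) hv hj le_rfl
    omega
  · intro v hv
    rw [put_of_ne _ _ (by simp)] at hv
    exact (hE.lt_of_row hm hv (Nat.lt_succ_self _)).le

theorem switch (h : E.RowState r w) (hm : E (r, b) = some w) (hb : r < b) :
    E.RowState (r + 1) (w + 1) where
  increasing := h.increasing
  origin := by
    rintro r₀ hr
    obtain rfl : r = r₀ := by omega
    refine ⟨b, hb, by rw [hm]; exact Option.some_ne_none _, ?_, ?_⟩
    · intro j v hj hv
      have := h.increasing.add_le hm hv le_rfl hj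
      omega
    · intro v hv
      exact h.increasing.lt_of_col hm hv (Nat.lt_succ_self _)

theorem switch_diag (h : E.RowState r w) (hm : E (r, r) = some w) :
    E.ColState (r + 1) (w + 1) := by
  refine ⟨h.increasing, r, r, rfl, by rw [hm]; exact Option.some_ne_none _, ?_, ?_⟩
  · intro j v hj hv
    have := h.increasing.add_le hm hv hj le_rfl
    omega
  · intro v hv
    exact h.increasing.lt_of_row hm hv (Nat.lt_succ_self _)

theorem append (h : E.RowState r w) (hb : r ≤ b) (hn : E (r, b) = none)
    (hocc : ∀ j, r ≤ j → j < b → E (r, j) ≠ none) (hlt : ∀ j v, E (r, j) = some v → v < w) :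
    (E.put (r, b) w).Increasing := by
  have hE := h.increasing
  apply hE.put hb
  · rintro c' rfl hr
    obtain ⟨u, hu⟩ := Option.ne_none_iff_exists'.1 (hocc c' hr (Nat.lt_succ_self _))
    exact ⟨u, hu, hlt _ _ hu⟩
  · intro v hv
    obtain ⟨u, hu, -⟩ := hE.row hv hb
    simp [hn] at hu
  · rintro r' rfl
    obtain ⟨b₀, hb₀, h0, h1, h2⟩ := h.origin r' rfl
    have hle : b ≤ b₀ := by
      by_contra hn
      obtain ⟨v, hv⟩ := Option.ne_none_iff_exists'.1 (hocc b₀ hb₀ (not_le.1 hn))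
      have := h2 v hv
      have := hlt _ v hv
      omega
    obtain ⟨v, hv⟩ := Option.ne_none_iff_exists'.1 h0
    obtain ⟨u, hu, -⟩ := hE.le hv le_rfl hle (by omega)
    exact ⟨u, hu, h1 b u hle hu⟩
  · intro v hv
    obtain ⟨u, hu, -⟩ := hE.col hv
    simp [hn] at hu

theorem word_bump (h : E.RowState r w) (hm : E (r, b) = some m) (hw : w < m)
    (hlt : ∀ j v, j < b → E (r, j) = some v → v < w) :
    E.rowStateWord r w = (E.put (r, b) w).rowStateWord (r + 1) m := by
  have hE := h.increasing
  have hE' := h.put_increasing hm hw hlt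
  rw [rowStateWord, rowStateWord, hE.word_rows_ge, hE'.word_rows_lt,
    hE.word_put hE' (S := {p | r + 1 ≤ p.1}) (by simp),
    hE.word_put hE' (S := {p | p.1 < r}) (by simp), mul_assoc (E.word {p | r + 1 ≤ p.1}),
    hE.row_bump hE' hm hw hlt]
  simp only [mul_assoc]

theorem word_switch (h : E.RowState r w) (hm : E (r, b) = some w)
    (hM : E (r, b + 1) = some (w + 1)) :
    E.rowStateWord r w = E.rowStateWord (r + 1) (w + 1) := by
  have hE := h.increasing
  rw [rowStateWord, rowStateWord, hE.word_rows_ge, hE.word_rows_lt,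
    mul_assoc (E.word {p | r + 1 ≤ p.1}), hE.row_switch hm hM]
  simp only [mul_assoc]

theorem word_append (h : E.RowState r w) (hb : r ≤ b) (hn : E (r, b) = none)
    (hocc : ∀ j, r ≤ j → j < b → E (r, j) ≠ none) (hlt : ∀ j v, E (r, j) = some v → v < w) :
    E.rowStateWord r w = (E.put (r, b) w).word Set.univ := by
  have hE := h.increasing
  have hE' := h.append hb hn hocc hlt
  have hr : ∀ j v, E (r, j) = some v → j < b := by
    intro j v hv
    by_contra hj
    obtain ⟨u, hu, -⟩ := hE.le hv le_rfl (not_lt.1 hj) hb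
    simp [hn] at hu
  have e1 : (E.put (r, b) w).word {p | p.1 = r ∧ b < p.2} = 1 := by
    rw [hE.word_put hE' (by simp)]
    apply hE.word_empty
    rintro _ j v hv ⟨rfl, hj⟩
    have := hr j v hv
    omega
  have e2 : E.word {p | p.1 = r ∧ p.2 < b} = E.word {p | p.1 = r} := by
    apply hE.word_congr hE
    rintro ⟨i, j⟩ v
    simp only [Set.mem_ofPred_eq]
    constructor
    · rintro ⟨⟨rfl, -⟩, hv⟩
      exact ⟨rfl, hv⟩
    · rintro ⟨rfl, hv⟩
      exact ⟨⟨rfl, hr j v hv⟩, hv⟩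
  rw [hE'.word_rows r, hE'.word_row (E.put_self _ _), e1, hE.word_put hE' (by simp),
    hE.word_put hE' (by simp), hE.word_put hE' (by simp), e2, rowStateWord, hE.word_rows_ge]
  simp only [mul_assoc, one_mul]

theorem consecutive (h : E.RowState r w) {t : WordMonoid} (hm : E (r, b) = some w)
    (hred : Reduced (E.rowStateWord r w * t)) : E (r, b + 1) = some (w + 1) := by
  have hE := h.increasing
  rw [rowStateWord, hE.word_rows_ge, mul_assoc _ _ t, mul_assoc (E.word {p | r + 1 ≤ p.1})] at hred
  exact hE.row_consecutive hm hred

theorem initial (hE : E.Increasing) (w : ℤ) : E.RowState 0 w :=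
  ⟨hE, fun r₀ h => by omega⟩

theorem initial_word (hE : E.Increasing) (w : ℤ) :
    E.rowStateWord 0 w = E.word Set.univ * gen w := by
  rw [rowStateWord, hE.word_empty (S := {p | p.1 < 0}) (by simp), mul_one]
  congr 3
  simp

end RowState

namespace ColState

variable {E : Filling} {b c : ℕ} {w m : ℤ}

theorem put_increasing (h : E.ColState c w) (hm : E (b, c) = some m) (hw : w < m)
    (hlt : ∀ j v, j < b → E (j, c) = some v → v < w) : (E.put (b, c) w).Increasing := by
  have hE := h.increasing
  apply hE.put (hE.diag hm)
  · rintro c' rfl hr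
    obtain ⟨u, hu, -⟩ := hE.row hm hr
    obtain ⟨c₀, b₀, hc, h0, h1, h2⟩ := h.origin
    obtain rfl : c' = c₀ := by omega
    refine ⟨u, hu, h1 b u ?_ hu⟩
    by_contra hn
    obtain ⟨v, hv, -⟩ := hE.le hm (le_of_not_ge hn) le_rfl (by have := hE.diag hm; omega)
    have := h2 v hv
    have := hlt _ v (not_le.1 hn) hv
    omega
  · intro v hv
    exact hw.trans (hE.lt_of_row hm hv (Nat.lt_succ_self _))
  · rintro r' rfl
    obtain ⟨u, hu, -⟩ := hE.col hm
    exact ⟨u, hu, hlt _ _ (Nat.lt_succ_self _) hu⟩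
  · intro v hv
    exact hw.trans (hE.lt_of_col hm hv (Nat.lt_succ_self _))

theorem bump (h : E.ColState c w) (hm : E (b, c) = some m) (hw : w < m)
    (hlt : ∀ j v, j < b → E (j, c) = some v → v < w) :
    (E.put (b, c) w).ColState (c + 1) m := by
  refine ⟨h.put_increasing hm hw hlt, c, b, rfl, by rw [put_self]; exact Option.some_ne_none _,
    ?_, ?_⟩
  · intro j v hj hv
    rcases E.put_eq_some.1 hv with ⟨-, -, rfl⟩ | ⟨hn, hv⟩
    · exact hw
    · exact (hlt j v (by omega) hv).trans hw
  · intro v hv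
    rw [put_of_ne _ _ (by simp)] at hv
    exact (h.increasing.lt_of_row hm hv (Nat.lt_succ_self _)).le

theorem switch (h : E.ColState c w) (hm : E (b, c) = some w) : E.ColState (c + 1) (w + 1) := by
  refine ⟨h.increasing, c, b, rfl, by rw [hm]; exact Option.some_ne_none _, ?_, ?_⟩
  · intro j v hj hv
    have := h.increasing.add_le hm hv hj le_rfl
    omega
  · intro v hv
    exact h.increasing.lt_of_row hm hv (Nat.lt_succ_self _)

/-- The new box at the top of a column has an occupied left neighbour. -/
theorem append_left (h : E.ColState c w) (hocc : ∀ j, j < b → E (j, c) ≠ none)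
    (hlt : ∀ j v, E (j, c) = some v → v < w) :
    ∃ c₀ u, c = c₀ + 1 ∧ E (b, c₀) = some u ∧ u < w := by
  obtain ⟨c₀, b₀, rfl, h0, h1, h2⟩ := h.origin
  have hE := h.increasing
  have hle : b ≤ b₀ := by
    by_contra hn
    obtain ⟨v, hv⟩ := Option.ne_none_iff_exists'.1 (hocc b₀ (not_le.1 hn))
    have := h2 v hv
    have := hlt _ v hv
    omega
  obtain ⟨v, hv⟩ := Option.ne_none_iff_exists'.1 h0
  obtain ⟨u, hu, -⟩ := hE.le hv hle le_rfl (by have := hE.diag hv; omega)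
  exact ⟨c₀, u, rfl, hu, h1 b u hle hu⟩

theorem append (h : E.ColState c w) (hn : E (b, c) = none)
    (hocc : ∀ j, j < b → E (j, c) ≠ none) (hlt : ∀ j v, E (j, c) = some v → v < w) :
    (E.put (b, c) w).Increasing := by
  have hE := h.increasing
  obtain ⟨c₀, u, rfl, hu, huw⟩ := h.append_left hocc hlt
  have hd := hE.diag hu
  apply hE.put (by omega)
  · intro c' hc hr
    obtain rfl : c₀ = c' := by omega
    exact ⟨u, hu, huw⟩
  · intro v hv
    obtain ⟨u, hu, -⟩ := hE.row hv (by omega)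
    simp [hn] at hu
  · rintro r' rfl
    obtain ⟨u, hu⟩ := Option.ne_none_iff_exists'.1 (hocc r' (Nat.lt_succ_self _))
    exact ⟨u, hu, hlt _ _ hu⟩
  · intro v hv
    obtain ⟨u, hu, -⟩ := hE.col hv
    simp [hn] at hu

theorem word_bump (h : E.ColState c w) (hm : E (b, c) = some m) (hw : w < m)
    (hlt : ∀ j v, j < b → E (j, c) = some v → v < w) :
    E.colStateWord c w = (E.put (b, c) w).colStateWord (c + 1) m := by
  have hE := h.increasing
  have hE' := h.put_increasing hm hw hlt
  rw [colStateWord, colStateWord, hE.word_cols_ge, hE'.word_cols_lt,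
    hE.word_put hE' (S := {p | c + 1 ≤ p.2}) (by simp),
    hE.word_put hE' (S := {p | p.2 < c}) (by simp), mul_assoc _ (gen w), ← mul_assoc (gen w),
    hE.col_bump hE' hm hw hlt]
  simp only [mul_assoc]

theorem word_switch (h : E.ColState c w) (hm : E (b, c) = some w)
    (hM : E (b + 1, c) = some (w + 1)) :
    E.colStateWord c w = E.colStateWord (c + 1) (w + 1) := by
  have hE := h.increasing
  rw [colStateWord, colStateWord, hE.word_cols_ge, hE.word_cols_lt, mul_assoc _ (gen w),
    ← mul_assoc (gen w), hE.col_switch hm hM]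
  simp only [mul_assoc]

theorem word_append (h : E.ColState c w) (hn : E (b, c) = none)
    (hocc : ∀ j, j < b → E (j, c) ≠ none) (hlt : ∀ j v, E (j, c) = some v → v < w) :
    E.colStateWord c w = (E.put (b, c) w).word Set.univ := by
  have hE := h.increasing
  have hE' := h.append hn hocc hlt
  have hr : ∀ j v, E (j, c) = some v → j < b := by
    intro j v hv
    by_contra hj
    have := hE.diag hv
    obtain ⟨u, hu, -⟩ := hE.le hv (not_lt.1 hj) le_rfl (by omega)
    simp [hn] at hu
  have e1 : (E.put (b, c) w).word {p | p.2 = c ∧ b < p.1} = 1 := by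
    rw [hE.word_put hE' (by simp)]
    apply hE.word_empty
    rintro j _ v hv ⟨rfl, hj⟩
    have := hr j v hv
    omega
  have e2 : E.word {p | p.2 = c ∧ p.1 < b} = E.word {p | p.2 = c} := by
    apply hE.word_congr hE
    rintro ⟨i, j⟩ v
    simp only [Set.mem_ofPred_eq]
    constructor
    · rintro ⟨⟨rfl, -⟩, hv⟩
      exact ⟨rfl, hv⟩
    · rintro ⟨rfl, hv⟩
      exact ⟨⟨rfl, hr i v hv⟩, hv⟩
  rw [hE'.word_cols c, hE'.word_col (E.put_self _ _), e1, hE.word_put hE' (by simp),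
    hE.word_put hE' (by simp), hE.word_put hE' (by simp), e2, colStateWord, hE.word_cols_ge]
  simp only [mul_assoc, one_mul]

theorem consecutive (h : E.ColState c w) {t : WordMonoid} (hm : E (b, c) = some w)
    (hred : Reduced (E.colStateWord c w * t)) : E (b + 1, c) = some (w + 1) := by
  have hE := h.increasing
  rw [colStateWord, hE.word_cols_ge, mul_assoc _ (gen w), ← mul_assoc (gen w),
    ← mul_assoc (E.word {p | p.2 < c}), mul_assoc _ _ t] at hred
  exact hE.col_consecutive hm hred

end ColState

end Filling

/-! ## Tableaux as fillings -/

theorem List.findIdx?_eq_some_of_forall_lt {α : Type*} {p : α → Bool} {l : List α} {k : ℕ} {x : α}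
    (hx : l[k]? = some x) (hp : p x = true)
    (h : ∀ j y, j < k → l[j]? = some y → p y = false) : l.findIdx? p = some k := by
  obtain ⟨hk, rfl⟩ := List.getElem?_eq_some_iff.1 hx
  rw [List.findIdx?_eq_some_iff_getElem]
  refine ⟨hk, hp, fun j hj => ?_⟩
  rw [h j _ hj (List.getElem?_eq_getElem (hj.trans hk))]
  exact Bool.false_ne_true

theorem List.getElem?_filterMap_range {α : Type*} (f : ℕ → Option α)
    (hf : ∀ k, f (k + 1) ≠ none → f k ≠ none) (n k : ℕ) :
    ((List.range n).filterMap fun r => (f r).map fun x => (r, x))[k]? =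
      if k < n then (f k).map fun x => (k, x) else none := by
  induction n generalizing k with
  | zero => simp
  | succ n ih =>
    rw [List.range_succ, List.filterMap_append]
    set L := (List.range n).filterMap fun r => (f r).map fun x => (r, x) with hL
    rcases hn : f n with _ | x
    · simp only [List.filterMap_cons, hn, Option.map_none, List.filterMap_nil, List.append_nil, ih]
      rcases lt_trichotomy k n with h | rfl | h
      · rw [if_pos h, if_pos (by omega)]
      · simp [hn]
      · rw [if_neg (by omega), if_neg (by omega)]
    · have hlow : ∀ j, f (n - j) ≠ none := by
        intro j
        induction j with
        | zero => simp [hn]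
        | succ j ihj =>
          rcases Nat.eq_zero_or_pos (n - j) with h | h
          · rwa [show n - (j + 1) = n - j by omega]
          · exact hf _ (by rwa [show n - (j + 1) + 1 = n - j by omega])
      have hlen : L.length = n := by
        apply le_antisymm
        · rw [← List.getElem?_eq_none_iff, ih, if_neg (lt_irrefl n)]
        · by_contra hlt
          have h := ih L.length
          rw [if_pos (by omega), List.getElem?_eq_none le_rfl] at h
          have h' := hlow (n - L.length)
          rw [show n - (n - L.length) = L.length by omega] at h'
          exact h' (Option.map_eq_none_iff.1 h.symm)
      simp only [List.filterMap_cons, hn, Option.map_some, List.filterMap_nil]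
      rcases lt_trichotomy k n with h | rfl | h
      · rw [List.getElem?_append_left (by omega), ih, if_pos h, if_pos (by omega)]
      · rw [List.getElem?_append_right (by omega), hlen]
        simp [hn]
      · rw [if_neg (by omega), List.getElem?_eq_none]
        simp
        omega

/-- The filling by the ceilings of the entries. -/
def ent (T : STab) : Filling := fun p => (entry? T p.1 p.2).map Letter.ceil

theorem entry?_add (T : STab) (r k : ℕ) : entry? T r (r + k) = (T.getD r [])[k]? := by
  rw [entry?, entryG?, if_pos (Nat.le_add_right r k), Nat.add_sub_cancel_left, List.getD]
  rcases T[r]? with _ | row <;> simp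

theorem entry?_of_le (T : STab) {r c : ℕ} (h : r ≤ c) :
    entry? T r c = (T.getD r [])[c - r]? := by
  rw [← entry?_add, Nat.add_sub_cancel' h]

theorem ent_add (T : STab) (r k : ℕ) : ent T (r, r + k) = (T.getD r [])[k]?.map Letter.ceil := by
  rw [ent, entry?_add]

theorem ent_of_lt (T : STab) {r c : ℕ} (h : c < r) : ent T (r, c) = none := by
  simp only [ent, entry?, entryG?, if_neg (not_le.2 h), Option.map_none]

theorem ent_of_le (T : STab) {r c : ℕ} (h : r ≤ c) :
    ent T (r, c) = (T.getD r [])[c - r]?.map Letter.ceil := by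
  rw [← ent_add, Nat.add_sub_cancel' h]

theorem ent_ne_none_iff {T : STab} {r c : ℕ} :
    ent T (r, c) ≠ none ↔ r ≤ c ∧ c - r < (T.getD r []).length := by
  by_cases h : r ≤ c
  · rw [ent_of_le T h]
    simp [h]
  · rw [ent_of_lt T (not_le.1 h)]
    simp [h]

theorem lt_length_of_ent {T : STab} {r c : ℕ} (h : ent T (r, c) ≠ none) : r < T.length := by
  by_contra hr
  have := (ent_ne_none_iff.1 h).2
  rw [List.getD_eq_default _ _ (not_lt.1 hr)] at this
  simp at this

theorem getD_unprimeT (T : STab) (r : ℕ) :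
    (unprimeT T).getD r [] = (T.getD r []).map Letter.unprime := by
  rw [unprimeT, List.getD, List.getD, List.getElem?_map]
  rcases T[r]? with _ | row <;> rfl

theorem entry?_unprimeT (T : STab) (r c : ℕ) :
    entry? (unprimeT T) r c = (entry? T r c).map Letter.unprime := by
  by_cases h : r ≤ c
  · rw [entry?_of_le _ h, entry?_of_le _ h, getD_unprimeT, List.getElem?_map]
  · simp only [entry?, entryG?, if_neg h, Option.map_none]

theorem ent_unprimeT (T : STab) : ent (unprimeT T) = ent T := by
  funext p
  rw [ent, ent, entry?_unprimeT, Option.map_map]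
  rfl

theorem length_unprimeT (T : STab) : (unprimeT T).length = T.length := List.length_map _

theorem shapeOf_unprimeT (T : STab) : shapeOf (unprimeT T) = shapeOf T := by
  simp [shapeOf, unprimeT, Function.comp_def]

theorem unprimeT_setRowG (T : STab) (r : ℕ) (row : List Letter) :
    unprimeT (setRowG T r row) = setRowG (unprimeT T) r (row.map Letter.unprime) := by
  rw [setRowG, setRowG, length_unprimeT]
  split_ifs <;> simp [unprimeT, List.map_set]

theorem unprimeT_setEntryG (T : STab) (r c : ℕ) (x : Letter) :
    unprimeT (setEntryG T r c x) = setEntryG (unprimeT T) r c x.unprime := by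
  rw [setEntryG, setEntryG, getD_unprimeT, ← List.map_set]
  simp [unprimeT, List.map_set]

theorem setRowG_set (T : STab) {r k : ℕ} (x : Letter) (h : r < T.length) :
    setRowG T r ((T.getD r []).set k x) = setEntryG T r (r + k) x := by
  rw [setRowG, if_pos h, setEntryG, Nat.add_sub_cancel_left]

theorem setRowG_set_set (T : STab) {r k l : ℕ} (x y : Letter) (h : r < T.length) :
    setRowG T r (((T.getD r []).set k x).set l y) =
      setEntryG (setEntryG T r (r + k) x) r (r + l) y := by
  rw [setRowG, if_pos h, setEntryG, setEntryG, Nat.add_sub_cancel_left, Nat.add_sub_cancel_left]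
  simp [List.getD, h]

theorem shapeOf_getD {α : Type*} (T : List (List α)) (r : ℕ) :
    (shapeOf T).getD r 0 = (T.getD r []).length := by
  rw [shapeOf, List.getD, List.getD, List.getElem?_map]
  rcases T[r]? with _ | row <;> rfl

theorem length_shapeOf {α : Type*} (T : List (List α)) : (shapeOf T).length = T.length :=
  List.length_map _

theorem shapeOf_setEntryG (T : STab) (r c : ℕ) (x : Letter) :
    shapeOf (setEntryG T r c x) = shapeOf T := by
  rw [setEntryG, shapeOf, List.map_set, List.length_set, ← shapeOf_getD, shapeOf]
  apply List.ext_getElem (by simp)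
  intro i h1 h2
  rw [List.getElem_set]
  split_ifs with hr
  · subst hr
    simp only [List.length_map] at h2
    simp [List.getD, h2]
  · rfl

theorem getD_set_self {α : Type*} (T : List (List α)) {r : ℕ} (row : List α)
    (h : r < T.length) : (T.set r row).getD r [] = row := by
  simp [List.getD, h]

theorem getD_set_ne {α : Type*} (T : List (List α)) {r i : ℕ} (row : List α) (h : r ≠ i) :
    (T.set r row).getD i [] = T.getD i [] := by
  simp [List.getD, List.getElem?_set_ne h]

theorem ent_setEntryG {T : STab} {r c : ℕ} (x : Letter) (h : ent T (r, c) ≠ none) :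
    ent (setEntryG T r c x) = (ent T).put (r, c) x.ceil := by
  have hr := lt_length_of_ent h
  obtain ⟨hrc, hc⟩ := ent_ne_none_iff.1 h
  funext ⟨i, j⟩
  by_cases hij : i ≤ j
  · rw [ent_of_le _ hij, setEntryG]
    by_cases hi : r = i
    · subst hi
      rw [getD_set_self _ _ hr]
      by_cases hj : c = j
      · subst hj
        rw [Filling.put_self, List.getElem?_set_self hc]
        rfl
      · rw [Filling.put_of_ne _ _ (by simp [Ne.symm hj]), List.getElem?_set_ne (by omega),
          ent_of_le _ hij]
    · rw [Filling.put_of_ne _ _ (by simp [Ne.symm hi]), getD_set_ne _ _ hi, ent_of_le _ hij]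
  · rw [ent_of_lt _ (not_le.1 hij), Filling.put_of_ne, ent_of_lt _ (not_le.1 hij)]
    rintro ⟨⟩
    exact hij hrc

/-- Append a box to a row, which may be the row after the last one. -/
def appendBox {α : Type*} (T : List (List α)) (r : ℕ) (x : α) : List (List α) :=
  setRowG T r (T.getD r [] ++ [x])

/-- Add a box to a row of a shape. -/
def addAt (sh : List ℕ) (r : ℕ) : List ℕ :=
  if r < sh.length then sh.set r (sh.getD r 0 + 1) else sh ++ [1]

theorem shapeOf_appendBox {α : Type*} (T : List (List α)) (r : ℕ) (x : α) :
    shapeOf (appendBox T r x) = addAt (shapeOf T) r := by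
  rw [appendBox, setRowG, addAt, shapeOf_getD, length_shapeOf]
  split_ifs with hr
  · simp [shapeOf, List.map_set]
  · rw [List.getD_eq_default _ _ (not_lt.1 hr)]
    simp [shapeOf]

theorem getD_appendBox {α : Type*} (T : List (List α)) {r : ℕ} (x : α) (h : r ≤ T.length) (i : ℕ) :
    (appendBox T r x).getD i [] = if i = r then T.getD r [] ++ [x] else T.getD i [] := by
  rw [appendBox, setRowG]
  split_ifs with hr hi hi
  · rw [hi, getD_set_self _ _ hr]
  · rw [getD_set_ne _ _ (Ne.symm hi)]
  · obtain rfl : r = T.length := by omega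
    simp [hi]
  · obtain rfl : r = T.length := by omega
    rcases lt_or_gt_of_ne hi with h' | h'
    · simp [List.getD, List.getElem?_append_left h']
    · rw [List.getD_eq_default _ _ (by simp; omega), List.getD_eq_default _ _ (by omega)]

theorem ent_appendBox {T : STab} {r : ℕ} (x : Letter) (h : r ≤ T.length) :
    ent (appendBox T r x) = (ent T).put (r, r + (T.getD r []).length) x.ceil := by
  funext ⟨i, j⟩
  by_cases hij : i ≤ j
  · rw [ent_of_le _ hij, getD_appendBox _ _ h]
    split_ifs with hi
    · subst hi
      by_cases hj : j = i + (T.getD i []).length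
      · subst hj
        rw [Filling.put_self, Nat.add_sub_cancel_left]
        simp
      · rw [Filling.put_of_ne _ _ (by simpa using hj), ent_of_le _ hij]
        rcases lt_or_ge (j - i) (T.getD i []).length with h' | h'
        · rw [List.getElem?_append_left h']
        · rw [List.getElem?_eq_none (by rw [List.length_append, List.length_singleton]; omega),
            List.getElem?_eq_none h']
    · rw [Filling.put_of_ne _ _ (by simp [hi]), ent_of_le _ hij]
  · rw [ent_of_lt _ (not_le.1 hij), Filling.put_of_ne, ent_of_lt _ (not_le.1 hij)]
    rintro ⟨⟩
    omega

theorem unprimeT_appendBox (T : STab) (r : ℕ) (x : Letter) :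
    unprimeT (appendBox T r x) = appendBox (unprimeT T) r x.unprime := by
  rw [appendBox, appendBox, unprimeT_setRowG, getD_unprimeT, List.map_append]
  rfl

/-! ## Single steps of the insertion algorithm -/

section Steps

variable {T : STab} {r b c : ℕ} {w x y : Letter} (fuel : ℕ)

theorem egRow_append (h : ∀ j v, ent T (r, j) = some v → v < w.ceil) :
    egRow (fuel + 1) T r w =
      if T.getD r [] = [] ∧ w.primed = true then (appendBox T r w.unprime, true)
      else (appendBox T r w, false) := by
  have h1 : (T.getD r []).findIdx? (fun v => decide (w.ceil < v.ceil)) = none := by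
    rw [List.findIdx?_eq_none_iff]
    intro v hv
    obtain ⟨j, hj⟩ := List.mem_iff_getElem?.1 hv
    simpa using (h (r + j) v.ceil (by rw [ent_add, hj]; rfl)).le
  rw [egRow]
  simp only [h1, List.isEmpty_iff, appendBox]
  split_ifs with h2
  · rw [h2.1]
    rfl
  · rfl

theorem egRow_bump (hb : r ≤ b) (hx : entry? T r b = some x) (hw : w.ceil < x.ceil)
    (hlt : ∀ j v, j < b → ent T (r, j) = some v → v < w.ceil) :
    egRow (fuel + 1) T r w =
      if b = r then egCol fuel (setEntryG T r b w.unprime) (r + 1) ⟨x.ceil, w.primed⟩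
      else egRow fuel (setEntryG T r b w) (r + 1) x := by
  obtain ⟨k, rfl⟩ := Nat.exists_eq_add_of_le hb
  rw [entry?_add] at hx
  replace hlt : ∀ j v, j < k → (T.getD r [])[j]? = some v → v.ceil < w.ceil :=
    fun j v hj hv => hlt (r + j) v.ceil (by omega) (by rw [ent_add, hv]; rfl)
  have hr : r < T.length := by
    by_contra hr
    rw [List.getD_eq_default _ _ (not_lt.1 hr)] at hx
    simp at hx
  have h1 : (T.getD r []).findIdx? (fun v => decide (w.ceil < v.ceil)) = some k :=
    List.findIdx?_eq_some_of_forall_lt hx (by simpa using hw) fun j v hj hv => by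
      simpa using (hlt j v hj hv).le
  have h2 : (T.getD r []).findIdx? (fun v => decide (w.ceil ≤ v.ceil)) = some k :=
    List.findIdx?_eq_some_of_forall_lt hx (by simpa using hw.le) fun j v hj hv => by
      simpa using hlt j v hj hv
  have h3 : (T.getD r []).getD k default = x := by rw [List.getD, hx]; rfl
  rw [egRow]
  simp only [h1, h2, h3, Option.getD_some, if_true, Nat.add_eq_left]
  split_ifs with h
  · subst h
    rw [setRowG_set _ _ hr]
  · rw [setRowG_set _ _ hr]

theorem egRow_switch (hb : r ≤ b) (hx : entry? T r b = some x)
    (hy : entry? T r (b + 1) = some y) (hwx : x.ceil = w.ceil) (hwy : w.ceil < y.ceil)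
    (hlt : ∀ j v, j < b → ent T (r, j) = some v → v < w.ceil) :
    egRow (fuel + 1) T r w =
      if b = r then
        egCol fuel (setEntryG (setEntryG T r b (switchPrimes x y).1) r (b + 1)
          (switchPrimes x y).2) (r + 1) w.succL
      else
        egRow fuel (setEntryG (setEntryG T r b (switchPrimes x y).1) r (b + 1)
          (switchPrimes x y).2) (r + 1) w.succL := by
  obtain ⟨k, rfl⟩ := Nat.exists_eq_add_of_le hb
  rw [entry?_add] at hx
  rw [add_assoc, entry?_add] at hy
  replace hlt : ∀ j v, j < k → (T.getD r [])[j]? = some v → v.ceil < w.ceil :=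
    fun j v hj hv => hlt (r + j) v.ceil (by omega) (by rw [ent_add, hv]; rfl)
  have hr : r < T.length := by
    by_contra hr
    rw [List.getD_eq_default _ _ (not_lt.1 hr)] at hx
    simp at hx
  have h1 : (T.getD r []).findIdx? (fun v => decide (w.ceil < v.ceil)) = some (k + 1) :=
    List.findIdx?_eq_some_of_forall_lt hy (by simpa using hwy) fun j v hj hv => by
      rcases Nat.lt_succ_iff_lt_or_eq.1 hj with hj | rfl
      · simpa using (hlt j v hj hv).le
      · rw [hx] at hv
        cases hv
        simp [hwx]
  have h2 : (T.getD r []).findIdx? (fun v => decide (w.ceil ≤ v.ceil)) = some k :=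
    List.findIdx?_eq_some_of_forall_lt hx (by simp [hwx]) fun j v hj hv => by
      simpa using hlt j v hj hv
  have h3 : (T.getD r []).getD k default = x := by rw [List.getD, hx]; rfl
  have h4 : (T.getD r []).getD (k + 1) default = y := by rw [List.getD, hy]; rfl
  rw [egRow]
  simp only [h1, h2, h3, h4, Option.getD_some, if_neg (Nat.lt_succ_self k).ne,
    Nat.add_eq_left]
  rw [setRowG_set_set _ _ _ hr]
  rfl

/-- The occupied boxes of a column, from bottom to top. -/
def colEntries (T : STab) (c : ℕ) : List (ℕ × Letter) :=
  (List.range (c + 1)).filterMap fun r => (entry? T r c).map fun x => (r, x)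

theorem getElem?_colEntries (hT : (ent T).Increasing) (c k : ℕ) :
    (colEntries T c)[k]? = (entry? T k c).map fun x => (k, x) := by
  rw [colEntries, List.getElem?_filterMap_range]
  · split_ifs with h
    · rfl
    · rw [entry?, entryG?, if_neg (by omega)]
      rfl
  · intro j hj hn
    obtain ⟨v, hv⟩ := Option.ne_none_iff_exists'.1 hj
    obtain ⟨u, hu, -⟩ := hT.col (r := j) (c := c) (v := v.ceil) (by simp [ent, hv])
    simp [ent, hn] at hu

theorem egCol_append (hT : (ent T).Increasing) (h : ∀ j v, ent T (j, c) = some v → v < w.ceil)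
    (hc : (colEntries T c).length ≠ c) :
    egCol (fuel + 1) T c w = (appendBox T (colEntries T c).length w, true) := by
  have h1 : (colEntries T c).findIdx? (fun p => decide (w.ceil < p.2.ceil)) = none := by
    rw [List.findIdx?_eq_none_iff]
    intro p hp
    obtain ⟨j, hj⟩ := List.mem_iff_getElem?.1 hp
    rw [getElem?_colEntries hT, Option.map_eq_some_iff] at hj
    obtain ⟨v, hv, rfl⟩ := hj
    simpa using (h j v.ceil (by rw [ent, hv]; rfl)).le
  rw [egCol]
  simp only [← colEntries.eq_1, h1, appendBox, hc, false_and, if_false]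

theorem egCol_bump (hT : (ent T).Increasing) (hx : entry? T b c = some x) (hw : w.ceil < x.ceil)
    (hlt : ∀ j v, j < b → ent T (j, c) = some v → v < w.ceil) :
    egCol (fuel + 1) T c w =
      if b = c then egCol fuel (setEntryG T b c w.unprime) (c + 1) ⟨x.ceil, w.primed⟩
      else egCol fuel (setEntryG T b c w) (c + 1) x := by
  replace hx : (colEntries T c)[b]? = some (b, x) := by
    rw [getElem?_colEntries hT, hx]
    rfl
  replace hlt : ∀ j v, j < b → (colEntries T c)[j]? = some v → v.2.ceil < w.ceil := by
    intro j p hj hp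
    rw [getElem?_colEntries hT, Option.map_eq_some_iff] at hp
    obtain ⟨v, hv, rfl⟩ := hp
    exact hlt j v.ceil hj (by rw [ent, hv]; rfl)
  have h1 : (colEntries T c).findIdx? (fun p => decide (w.ceil < p.2.ceil)) = some b :=
    List.findIdx?_eq_some_of_forall_lt hx (by simpa using hw) fun j v hj hv => by
      simpa using (hlt j v hj hv).le
  have h2 : (colEntries T c).findIdx? (fun p => decide (w.ceil ≤ p.2.ceil)) = some b :=
    List.findIdx?_eq_some_of_forall_lt hx (by simpa using hw.le) fun j v hj hv => by
      simpa using hlt j v hj hv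
  have h3 : (colEntries T c).getD b (0, default) = (b, x) := by rw [List.getD, hx]; rfl
  rw [egCol]
  simp only [← colEntries.eq_1, h1, h2, h3, Option.getD_some, if_true]

theorem egCol_switch (hT : (ent T).Increasing) (hx : entry? T b c = some x)
    (hy : entry? T (b + 1) c = some y) (hwx : x.ceil = w.ceil) (hwy : w.ceil < y.ceil)
    (hlt : ∀ j v, j < b → ent T (j, c) = some v → v < w.ceil) :
    egCol (fuel + 1) T c w =
      egCol fuel (setEntryG (setEntryG T b c (switchPrimes x y).1) (b + 1) c (switchPrimes x y).2)
        (c + 1) w.succL := by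
  replace hy : (colEntries T c)[b + 1]? = some (b + 1, y) := by
    rw [getElem?_colEntries hT, hy]
    rfl
  replace hx : (colEntries T c)[b]? = some (b, x) := by
    rw [getElem?_colEntries hT, hx]
    rfl
  replace hlt : ∀ j v, j < b → (colEntries T c)[j]? = some v → v.2.ceil < w.ceil := by
    intro j p hj hp
    rw [getElem?_colEntries hT, Option.map_eq_some_iff] at hp
    obtain ⟨v, hv, rfl⟩ := hp
    exact hlt j v.ceil hj (by rw [ent, hv]; rfl)
  have h1 : (colEntries T c).findIdx? (fun p => decide (w.ceil < p.2.ceil)) = some (b + 1) :=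
    List.findIdx?_eq_some_of_forall_lt hy (by simpa using hwy) fun j v hj hv => by
      rcases Nat.lt_succ_iff_lt_or_eq.1 hj with hj | rfl
      · simpa using (hlt j v hj hv).le
      · rw [hx] at hv
        cases hv
        simp [hwx]
  have h2 : (colEntries T c).findIdx? (fun p => decide (w.ceil ≤ p.2.ceil)) = some b :=
    List.findIdx?_eq_some_of_forall_lt hx (by simp [hwx]) fun j v hj hv => by
      simpa using hlt j v hj hv
  have h3 : (colEntries T c).getD b (0, default) = (b, x) := by rw [List.getD, hx]; rfl
  have h4 : (colEntries T c).getD (b + 1) (0, default) = (b + 1, y) := by rw [List.getD, hy]; rfl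
  rw [egCol]
  simp only [← colEntries.eq_1, h1, h2, h3, h4, Option.getD_some, if_neg (Nat.lt_succ_self b).ne]

theorem colEntries_unprimeT (T : STab) (c : ℕ) :
    colEntries (unprimeT T) c = (colEntries T c).map (Prod.map id Letter.unprime) := by
  rw [colEntries, colEntries, List.map_filterMap]
  congr 1
  funext r
  rw [entry?_unprimeT, Option.map_map, Option.map_map]
  rfl

theorem switchPrimes_unprime (x y : Letter) :
    (switchPrimes x y).1.unprime = x.unprime ∧ (switchPrimes x y).2.unprime = y.unprime := by
  rw [switchPrimes]
  split_ifs <;> exact ⟨rfl, rfl⟩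

theorem switchPrimes_ceil (x y : Letter) :
    (switchPrimes x y).1.ceil = x.ceil ∧ (switchPrimes x y).2.ceil = y.ceil := by
  rw [switchPrimes]
  split_ifs <;> exact ⟨rfl, rfl⟩

end Steps

/-! ## Insertion of a letter and removal of primes -/

open WordMonoid

/-- `R` and `R'` are the outcomes of corresponding insertions into `T` and `unprimeT T`; the
resulting tableau has a reading word equivalent to `x`. -/
def InsertedAlong (T : STab) (x : WordMonoid) (R R' : STab × Bool) : Prop :=
  R'.1 = unprimeT R.1 ∧ (ent R.1).Increasing ∧ InvEq x ((ent R.1).word Set.univ) ∧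
    ∃ r, shapeOf R.1 = addAt (shapeOf T) r ∧
      ((r < T.length ∧ R'.2 = R.2) ∨ (r = T.length ∧ R'.2 = false))

theorem InsertedAlong.of_eq {T T' : STab} {x y : WordMonoid} {R R' : STab × Bool}
    (h : InsertedAlong T' y R R') (hs : shapeOf T' = shapeOf T) (hxy : InvEq x y) :
    InsertedAlong T x R R' := by
  have hl : T'.length = T.length := by rw [← length_shapeOf, hs, length_shapeOf]
  rw [InsertedAlong, hs, hl] at h
  exact ⟨h.1, h.2.1, hxy.trans h.2.2.1, h.2.2.2⟩

theorem exists_first_ge {f : ℕ → Option ℤ} {w : ℤ} (h : ¬∀ j v, f j = some v → v < w) :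
    ∃ k v, f k = some v ∧ w ≤ v ∧ ∀ j u, j < k → f j = some u → u < w := by
  classical
  have h' : ∃ k, ∃ v, f k = some v ∧ w ≤ v := by
    by_contra hn
    exact h fun j v hv => by
      by_contra hw
      exact hn ⟨j, v, hv, not_lt.1 hw⟩
  obtain ⟨v, hv, hw⟩ := Nat.find_spec h'
  refine ⟨_, v, hv, hw, fun j u hj hu => ?_⟩
  by_contra hn
  exact Nat.find_min h' hj ⟨u, hu, not_lt.1 hn⟩

theorem exists_entry {T : STab} {r c : ℕ} {v : ℤ} (h : ent T (r, c) = some v) :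
    ∃ x, entry? T r c = some x ∧ x.ceil = v :=
  Option.map_eq_some_iff.1 h

theorem lt_numCols {T : STab} (hT : (ent T).Increasing) {r c : ℕ} (h : ent T (r, c) ≠ none) :
    c < numCols T := by
  obtain ⟨v, hv⟩ := Option.ne_none_iff_exists'.1 h
  obtain ⟨u, hu, -⟩ := hT.le hv (Nat.zero_le r) le_rfl (Nat.zero_le c)
  exact (ent_ne_none_iff.1 (hu ▸ Option.some_ne_none u)).2

theorem numCols_eq {T T' : STab} (h : shapeOf T' = shapeOf T) : numCols T' = numCols T := by
  rw [numCols, numCols, ← shapeOf_getD, h, shapeOf_getD]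

section Switch

variable {T : STab} {r c r' c' : ℕ} {x y : Letter}

theorem ent_switch (hx : entry? T r c = some x) (hy : entry? T r' c' = some y) :
    ent (setEntryG (setEntryG T r c (switchPrimes x y).1) r' c' (switchPrimes x y).2) = ent T := by
  have hx' : ent T (r, c) = some x.ceil := by rw [ent, hx]; rfl
  have hy' : ent T (r', c') = some y.ceil := by rw [ent, hy]; rfl
  have h1 : ent (setEntryG T r c (switchPrimes x y).1) = ent T := by
    rw [ent_setEntryG _ (by simp [hx']), (switchPrimes_ceil x y).1, Filling.put_eq_self hx']
  rw [ent_setEntryG _ (by simp [h1, hy']), h1, (switchPrimes_ceil x y).2, Filling.put_eq_self hy']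

theorem unprimeT_switch :
    unprimeT (setEntryG (setEntryG T r c (switchPrimes x y).1) r' c' (switchPrimes x y).2) =
      setEntryG (setEntryG (unprimeT T) r c (switchPrimes x.unprime y.unprime).1) r' c'
        (switchPrimes x.unprime y.unprime).2 := by
  rw [unprimeT_setEntryG, unprimeT_setEntryG, (switchPrimes_unprime x y).1,
    (switchPrimes_unprime x y).2]
  rfl

end Switch

theorem egCol_inserted (fuel : ℕ) (T : STab) (c : ℕ) (w : Letter) (t : WordMonoid)
    (h : (ent T).ColState c w.ceil) (hred : Reduced ((ent T).colStateWord c w.ceil * t))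
    (hfuel : numCols T + 1 ≤ fuel + c) :
    InsertedAlong T ((ent T).colStateWord c w.ceil) (egCol fuel T c w)
      (egCol fuel (unprimeT T) c w.unprime) := by
  have hT := h.increasing
  have hU : (ent (unprimeT T)).Increasing := by rwa [ent_unprimeT]
  induction fuel generalizing T c w with
  | zero =>
    obtain ⟨c₀, b, rfl, h0, -⟩ := h.origin
    have := lt_numCols hT h0
    omega
  | succ fuel ih =>
    by_cases hlt : ∀ j v, ent T (j, c) = some v → v < w.ceil
    · set n := (colEntries T c).length with hn
      have hn1 : ent T (n, c) = none := by
        have := getElem?_colEntries hT c n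
        rw [List.getElem?_eq_none le_rfl] at this
        rw [ent, Option.map_eq_none_iff.1 this.symm]
        rfl
      have hn2 : ∀ j, j < n → ent T (j, c) ≠ none := by
        intro j hj h0
        have := getElem?_colEntries hT c j
        rw [Option.map_eq_none_iff.1 h0, List.getElem?_eq_getElem hj] at this
        cases this
      obtain ⟨c₀, u, hc, hu, -⟩ := h.append_left hn2 hlt
      have hu' : ent T (n, c₀) ≠ none := by simp [hu]
      have hr := lt_length_of_ent hu'
      have hc' : c = n + (T.getD n []).length := by
        have := ent_ne_none_iff.1 hu'
        have := (not_congr ent_ne_none_iff).1 (not_not.2 hn1)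
        omega
      have hnc : n ≠ c := by
        have := ent_ne_none_iff.1 hu'
        omega
      have hent : ent (appendBox T n w) = (ent T).put (n, c) w.ceil := by
        rw [ent_appendBox _ hr.le, ← hc']
      have hlen : (colEntries (unprimeT T) c).length = n := by
        rw [colEntries_unprimeT, List.length_map]
      rw [egCol_append fuel hT hlt hnc,
        egCol_append fuel hU (by rwa [ent_unprimeT]) (by rwa [hlen]), hlen]
      refine ⟨(unprimeT_appendBox _ _ _).symm, ?_, ?_, n, shapeOf_appendBox _ _ _, Or.inl ⟨hr, rfl⟩⟩
      · dsimp only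
        rw [hent]
        exact h.append hn1 hn2 hlt
      · dsimp only
        rw [hent, ← h.word_append hn1 hn2 hlt]
        exact InvEq.refl _
    · obtain ⟨b, v, hv, hwv, hlt⟩ := exists_first_ge hlt
      obtain ⟨x, hx, rfl⟩ := exists_entry hv
      have hx' : entry? (unprimeT T) b c = some x.unprime := by rw [entry?_unprimeT, hx]; rfl
      have hlt' : ∀ j v, j < b → ent (unprimeT T) (j, c) = some v → v < w.unprime.ceil := by
        rwa [ent_unprimeT]
      rcases lt_or_eq_of_le hwv with hw | hw
      · have hnext : ∀ w₁ x₁ : Letter, w₁.ceil = w.ceil → x₁.ceil = x.ceil →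
            w₁.unprime = w.unprime → x₁.unprime = x.unprime →
            InsertedAlong T ((ent T).colStateWord c w.ceil)
              (egCol fuel (setEntryG T b c w₁) (c + 1) x₁)
              (egCol fuel (setEntryG (unprimeT T) b c w.unprime) (c + 1) x.unprime) := by
          intro w₁ x₁ h1 h2 h3 h4
          have hent : ent (setEntryG T b c w₁) = (ent T).put (b, c) w.ceil := by
            rw [ent_setEntryG _ (by simp [hv]), h1]
          have hst := h.bump hv hw hlt
          have hword := h.word_bump hv hw hlt
          rw [← hent, ← h2] at hst hword
          rw [hword] at hred ⊢
          rw [← h3, ← unprimeT_setEntryG, ← h4]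
          have hs := shapeOf_setEntryG T b c w₁
          refine InsertedAlong.of_eq (ih _ _ _ hst hred ?_ hst.increasing ?_) hs (InvEq.refl _)
          · rw [numCols_eq hs]
            omega
          · rw [ent_unprimeT]
            exact hst.increasing
        rw [egCol_bump fuel hT hx hw hlt, egCol_bump (w := w.unprime) fuel hU hx' hw hlt']
        split_ifs
        · exact hnext w.unprime ⟨x.ceil, w.primed⟩ rfl rfl rfl rfl
        · exact hnext w x rfl rfl rfl rfl
      · rw [← hw] at hv
        have hy := h.consecutive hv hred
        have hst := h.switch hv
        have hword := h.word_switch hv hy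
        obtain ⟨y, hy, hyw⟩ := exists_entry hy
        have hy' : entry? (unprimeT T) (b + 1) c = some y.unprime := by
          rw [entry?_unprimeT, hy]; rfl
        have hwy : w.ceil < y.ceil := by omega
        rw [egCol_switch fuel hT hx hy hw.symm hwy hlt,
          egCol_switch (w := w.unprime) fuel hU hx' hy' hw.symm hwy hlt', ← unprimeT_switch]
        rw [← ent_switch hx hy] at hst
        rw [hword] at hred ⊢
        rw [← ent_switch hx hy] at hred ⊢
        set T₁ := setEntryG (setEntryG T b c (switchPrimes x y).1) (b + 1) c (switchPrimes x y).2
          with hT₁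
        have hs : shapeOf T₁ = shapeOf T := by
          rw [hT₁, shapeOf_setEntryG, shapeOf_setEntryG]
        refine InsertedAlong.of_eq (ih T₁ _ w.succL hst hred ?_ hst.increasing ?_) hs (InvEq.refl _)
        · rw [numCols_eq hs]
          omega
        · rw [ent_unprimeT]
          exact hst.increasing

theorem egRow_inserted (fuel : ℕ) (T : STab) (r : ℕ) (w : Letter) (t : WordMonoid)
    (h : (ent T).RowState r w.ceil) (hred : Reduced ((ent T).rowStateWord r w.ceil * t))
    (hfuel : numCols T + 1 ≤ fuel + r) (hrows : 0 ∉ shapeOf T) :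
    InsertedAlong T ((ent T).rowStateWord r w.ceil) (egRow fuel T r w)
      (egRow fuel (unprimeT T) r w.unprime) := by
  have hT := h.increasing
  induction fuel generalizing T r w with
  | zero =>
    rcases r with _ | r₀
    · omega
    · obtain ⟨b, hb, h0, -⟩ := h.origin r₀ rfl
      have := lt_numCols hT h0
      omega
  | succ fuel ih =>
    by_cases hlt : ∀ j v, ent T (r, j) = some v → v < w.ceil
    · set n := (T.getD r []).length with hn
      have hn1 : ent T (r, r + n) = none := by
        by_contra h0
        have := ent_ne_none_iff.1 h0
        omega
      have hn2 : ∀ j, r ≤ j → j < r + n → ent T (r, j) ≠ none :=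
        fun j hj hj' => ent_ne_none_iff.2 ⟨hj, by omega⟩
      have hr : r ≤ T.length := by
        rcases r with _ | r₀
        · exact Nat.zero_le _
        · obtain ⟨b, hb, h0, -⟩ := h.origin r₀ rfl
          exact lt_length_of_ent h0
      have hfin : ∀ (w₁ : Letter) (f f' : Bool), w₁.ceil = w.ceil → w₁.unprime = w.unprime →
          ((r < T.length ∧ f' = f) ∨ (r = T.length ∧ f' = false)) →
          InsertedAlong T ((ent T).rowStateWord r w.ceil) (appendBox T r w₁, f)
            (appendBox (unprimeT T) r w.unprime, f') := by
        intro w₁ f f' h1 h2 hf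
        have hent : ent (appendBox T r w₁) = (ent T).put (r, r + n) w.ceil := by
          rw [ent_appendBox _ hr, h1]
        refine ⟨by rw [unprimeT_appendBox, h2], ?_, ?_, r, shapeOf_appendBox _ _ _, hf⟩
        · dsimp only
          rw [hent]
          exact h.append (Nat.le_add_right r n) hn1 hn2 hlt
        · dsimp only
          rw [hent, ← h.word_append (Nat.le_add_right r n) hn1 hn2 hlt]
          exact InvEq.refl _
      rw [egRow_append fuel hlt, egRow_append fuel (by rwa [ent_unprimeT]),
        if_neg (show ¬((unprimeT T).getD r [] = [] ∧ w.unprime.primed = true) by simp [Letter.unprime])]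
      split_ifs with hw
      · refine hfin _ _ _ rfl rfl (Or.inr ⟨hr.antisymm (not_lt.1 fun hr => hrows ?_), rfl⟩)
        rw [shapeOf, List.mem_map]
        refine ⟨T.getD r [], ?_, by rw [hw.1]; rfl⟩
        simp [List.getD, hr]
      · refine hfin _ _ _ rfl rfl ?_
        rcases hr.lt_or_eq with hr | hr
        · exact Or.inl ⟨hr, rfl⟩
        · exact Or.inr ⟨hr, rfl⟩
    · obtain ⟨b, v, hv, hwv, hlt⟩ := exists_first_ge hlt
      obtain ⟨x, hx, rfl⟩ := exists_entry hv
      have hb := hT.diag hv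
      have hx' : entry? (unprimeT T) r b = some x.unprime := by rw [entry?_unprimeT, hx]; rfl
      have hlt' : ∀ j v, j < b → ent (unprimeT T) (r, j) = some v → v < w.unprime.ceil := by
        rwa [ent_unprimeT]
      rcases lt_or_eq_of_le hwv with hw | hw
      · rw [egRow_bump fuel hb hx hw hlt, egRow_bump (w := w.unprime) fuel hb hx' hw hlt']
        split_ifs with hbr
        · subst hbr
          have hent : ent (setEntryG T b b w.unprime) = (ent T).put (b, b) w.ceil :=
            ent_setEntryG _ (by simp [hv])
          have hword := hT.diag_bump (h.put_increasing hv hw hlt) hv hw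
          have hst := h.bump_diag hv hw
          rw [← hent] at hst hword
          have hs := shapeOf_setEntryG T b b w.unprime
          have := egCol_inserted fuel _ _ ⟨x.ceil, w.primed⟩ t hst (hword.reduced hred)
            (by rw [numCols_eq hs]; omega)
          rw [unprimeT_setEntryG] at this
          exact this.of_eq hs hword
        · have hent : ent (setEntryG T r b w) = (ent T).put (r, b) w.ceil :=
            ent_setEntryG _ (by simp [hv])
          have hst := h.bump hv hw hlt (by omega)
          have hword := h.word_bump hv hw hlt
          rw [← hent] at hst hword
          rw [hword] at hred ⊢
          have hs := shapeOf_setEntryG T r b w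
          rw [← unprimeT_setEntryG]
          refine InsertedAlong.of_eq (ih _ _ x hst hred ?_ ?_ hst.increasing) hs (InvEq.refl _)
          · rw [numCols_eq hs]
            omega
          · rwa [hs]
      · rw [← hw] at hv
        have hM := h.consecutive hv hred
        obtain ⟨y, hy, hyw⟩ := exists_entry hM
        have hy' : entry? (unprimeT T) r (b + 1) = some y.unprime := by
          rw [entry?_unprimeT, hy]; rfl
        have hwy : w.ceil < y.ceil := by omega
        rw [egRow_switch fuel hb hx hy hw.symm hwy hlt,
          egRow_switch (w := w.unprime) fuel hb hx' hy' hw.symm hwy hlt', ← unprimeT_switch]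
        have hent := ent_switch hx hy
        set T₁ := setEntryG (setEntryG T r b (switchPrimes x y).1) r (b + 1) (switchPrimes x y).2
          with hT₁
        have hs : shapeOf T₁ = shapeOf T := by
          rw [hT₁, shapeOf_setEntryG, shapeOf_setEntryG]
        split_ifs with hbr
        · subst hbr
          have hword := hT.diag_switch hv hM hred
          have hst := h.switch_diag hv
          have hred' := hword.reduced hred
          rw [← hent] at hst hred'
          have := egCol_inserted fuel _ _ w.succL t hst hred' (by rw [numCols_eq hs]; omega)
          rw [hent] at this
          exact this.of_eq hs hword
        · have hst := h.switch hv (by omega)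
          rw [h.word_switch hv hM] at hred ⊢
          rw [← hent] at hst hred ⊢
          refine InsertedAlong.of_eq (ih _ _ w.succL hst hred ?_ ?_ hst.increasing) hs
            (InvEq.refl _)
          · rw [numCols_eq hs]
            omega
          · rwa [hs]

theorem numCols_le (T : STab) : numCols T ≤ T.flatten.length := by
  rw [numCols]
  rcases T with _ | ⟨row, T⟩
  · simp
  · simp

theorem length_flatten_unprimeT (T : STab) :
    (unprimeT T).flatten.length = T.flatten.length := by
  rw [List.length_flatten, List.length_flatten]
  exact congrArg List.sum (shapeOf_unprimeT T)

theorem egInsert_inserted (T : STab) (u : Letter) (t : WordMonoid) (hT : (ent T).Increasing)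
    (hrows : 0 ∉ shapeOf T) (hred : Reduced ((ent T).word Set.univ * gen u.ceil * t)) :
    InsertedAlong T ((ent T).word Set.univ * gen u.ceil) (egInsert T u)
      (egInsert (unprimeT T) u.unprime) := by
  have hc := numCols_le T
  rw [egInsert, egInsert, length_flatten_unprimeT, length_unprimeT]
  rw [← Filling.RowState.initial_word hT] at hred ⊢
  exact egRow_inserted _ _ _ _ t (.initial hT _) hred (by omega) hrows

/-! ## Insertion of a word -/

theorem zero_notMem_addAt {sh : List ℕ} (h : 0 ∉ sh) (r : ℕ) : 0 ∉ addAt sh r := by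
  rw [addAt]
  split_ifs
  · intro h0
    rcases List.mem_or_eq_of_mem_set h0 with h0 | h0
    · exact h h0
    · omega
  · simpa using h

theorem getD_addAt {sh : List ℕ} {r : ℕ} (h : r ≤ sh.length) (i : ℕ) :
    (addAt sh r).getD i 0 = if i = r then sh.getD i 0 + 1 else sh.getD i 0 := by
  rw [addAt]
  rcases h.lt_or_eq with h | rfl
  · rw [if_pos h]
    split_ifs with hi
    · subst hi
      simp [List.getD, h]
    · simp [List.getD, List.getElem?_set_ne (Ne.symm hi)]
  · rw [if_neg (lt_irrefl _)]
    rcases lt_trichotomy i sh.length with hi | rfl | hi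
    · rw [if_neg hi.ne]
      simp [List.getD, List.getElem?_append_left hi]
    · simp [List.getD]
    · rw [if_neg hi.ne']
      simp only [List.getD]
      rw [List.getElem?_eq_none (by simpa using hi), List.getElem?_eq_none hi.le]

theorem lt_length_addAt {sh : List ℕ} {r : ℕ} (h : r ≤ sh.length) : r < (addAt sh r).length := by
  rw [addAt]
  split_ifs with hr
  · simpa using hr
  · simpa using h

theorem addBox_eq_appendBox {Q P P' : STab} {r : ℕ} (x : Letter)
    (h : shapeOf P' = addAt (shapeOf P) r) (hr : r ≤ P.length) :
    addBox Q P P' x = appendBox Q r x := by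
  have hr' : r ≤ (shapeOf P).length := by rwa [length_shapeOf]
  have hlen : r < P'.length := by
    rw [← length_shapeOf, h]
    exact lt_length_addAt hr'
  have hrow : ∀ i, decide ((P.getD i []).length ≠ (P'.getD i []).length) = decide (i = r) := by
    intro i
    rw [← shapeOf_getD, ← shapeOf_getD, h, getD_addAt hr']
    split_ifs with hi <;> simp [hi]
  have hfind : (List.range P'.length).find?
      (fun i => decide ((P.getD i []).length ≠ (P'.getD i []).length)) = some r := by
    rw [funext hrow, List.find?_range_eq_some]
    refine ⟨by simp, List.mem_range.2 hlen, fun j hj => ?_⟩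
    simpa using hj.ne
  rw [addBox, hfind]
  rfl

theorem unprimeDiagT_appendBox {Q : STab} {r : ℕ} {x y : Letter} (hQ : 0 ∉ shapeOf Q)
    (h : (r < Q.length ∧ y = x) ∨ (r = Q.length ∧ y = x.unprime)) :
    unprimeDiagT (appendBox Q r x) = appendBox (unprimeDiagT Q) r y := by
  rcases h with ⟨hr, rfl⟩ | ⟨rfl, rfl⟩
  · have hmem : (Q.getD r []) ∈ Q := by simp [List.getD, hr]
    have hne : Q.getD r [] ≠ [] := fun h0 =>
      hQ (List.mem_map.2 ⟨_, hmem, by rw [h0]; rfl⟩)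
    obtain ⟨z, row, hrow⟩ := List.exists_cons_of_ne_nil hne
    have hrow' : (unprimeDiagT Q).getD r [] = z.unprime :: row := by
      rw [List.getD_eq_getElem _ _ hr] at hrow
      rw [unprimeDiagT, List.getD_eq_getElem _ _ (by simpa using hr), List.getElem_map, hrow]
    rw [appendBox, appendBox, setRowG, setRowG, if_pos hr,
      if_pos (by simpa [unprimeDiagT] using hr), hrow, hrow', unprimeDiagT, unprimeDiagT,
      List.map_set]
    rfl
  · simp [appendBox, setRowG, unprimeDiagT, List.getD]

theorem insertion_unprime (a : PWord) (P Q : STab) (n : ℕ) (hP : (ent P).Increasing)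
    (hrows : 0 ∉ shapeOf P) (hQ : shapeOf Q = shapeOf P)
    (hred : Reduced ((ent P).word Set.univ * ofWord (unprimeWord a))) :
    (unprimeP a).foldl (fun T u => (egInsert T u).1) (unprimeT P) =
        unprimeT (a.foldl (fun T u => (egInsert T u).1) P) ∧
      QEGaux (unprimeT P) (unprimeDiagT Q) n (unprimeP a) = unprimeDiagT (QEGaux P Q n a) := by
  induction a generalizing P Q n with
  | nil => exact ⟨rfl, rfl⟩
  | cons u a ih =>
    rw [unprimeWord, List.map_cons, ofWord_cons, ← mul_assoc] at hred
    obtain ⟨hT, hinc, hword, r, hs, hr⟩ := egInsert_inserted P u _ hP hrows hred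
    have hle : r ≤ P.length := hr.elim (fun h => h.1.le) fun h => h.1.le
    have hlen : Q.length = P.length := by rw [← length_shapeOf, hQ, length_shapeOf]
    have hbox : addBox Q P (egInsert P u).1 ⟨n, (egInsert P u).2⟩ =
        appendBox Q r ⟨n, (egInsert P u).2⟩ := addBox_eq_appendBox _ hs hle
    have hbox' : addBox (unprimeDiagT Q) (unprimeT P) (egInsert (unprimeT P) u.unprime).1
        ⟨n, (egInsert (unprimeT P) u.unprime).2⟩ =
        unprimeDiagT (appendBox Q r ⟨n, (egInsert P u).2⟩) := by
      rw [addBox_eq_appendBox (r := r) _ (by rw [hT, shapeOf_unprimeT, shapeOf_unprimeT, hs])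
        (by rwa [length_unprimeT]), unprimeDiagT_appendBox (by rwa [hQ])]
      rw [hlen]
      refine hr.imp (fun h => ⟨h.1, ?_⟩) fun h => ⟨h.1, ?_⟩
      · rw [h.2]
      · rw [h.2]; rfl
    have hnext := ih (egInsert P u).1 (appendBox Q r ⟨n, (egInsert P u).2⟩) (n + 1) hinc
      (hs ▸ zero_notMem_addAt hrows r) (by rw [shapeOf_appendBox, hQ, hs]) (hword.reduced hred)
    rw [← hT, ← hbox', ← hbox] at hnext
    exact hnext

/-- Proposition 3.12: for a primed involution word `a`,
`P_EGᴼ(unprime(a)) = unprime(P_EGᴼ(a))` and `Q_EGᴼ(unprime(a)) = unprime_diag(Q_EGᴼ(a))`. -/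
theorem stmt5 (z : Equiv.Perm ℤ) (hz : IZ z) (a : PWord) (ha : a ∈ RinvPlus z) :
    PEG (unprimeP a) = unprimeT (PEG a) ∧ QEG (unprimeP a) = unprimeDiagT (QEG a) := by
  have hent : ∀ p, ent [] p = none := by simp [ent, entry?, entryG?]
  have hinc : (ent []).Increasing :=
    ⟨by simp [hent], by simp [hent], by simp [hent], by simp [hent]⟩
  have hred := reduced_ofWord ha.1
  refine insertion_unprime a [] [] 1 hinc (by simp [shapeOf]) rfl ?_
  rwa [hinc.word_empty (by simp [hent]), one_mul]
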